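/- arXiv:1811.07527 — 3 statements merged into one kernel-verified Lean document; each statement's English description precedes it below -/
import Mathlib

section
/- Let m ∈ ℕ, μ ∈ (0,1], let P : ℝ^m → ℝ^m be an orthogonal projection, and let W ∈ C^∞(ℝ^m; ℝ) satisfy, for every multi-index γ, a bound |∂^γ W(x)| ≤ C_γ (1+|Px|²)^{(-μ-|γ|)/2} for all x ∈ ℝ^m. Let χ₀ ∈ C^∞(ℝ) with χ₀(t) = 0 for t < 1 and χ₀(t) = 1 for t > 2. For K > 0 define f_K(x) := W(x) · χ₀( ⟨Px⟩ log⟨x⟩ / ⟨x⟩ ) · χ₀( |x| / K ), where ⟨y⟩ := (1+|y|²)^{1/2}. Then for every μ₀ ∈ (0, μ) there exists K > 0 such that f_K ∈ C^∞(ℝ^m) and for every multi-index γ there is C'_γ > 0 with |∂^γ f_K(x)| ≤ C'_γ (1+|x|)^{-μ₀-|γ|} for all x ∈ ℝ^m. -/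
open MeasureTheory Metric Filter
open scoped ENNReal RealInnerProductSpace Topology

noncomputable section

/-- Euclidean space `ℝ^m`. -/
abbrev Euc (n : ℕ) := EuclideanSpace ℝ (Fin n)

def jb {E : Type*} [NormedAddCommGroup E] (x : E) : ℝ := Real.sqrt (1 + ‖x‖ ^ 2)

lemma jb_one_le {E : Type*} [NormedAddCommGroup E] (x : E) : 1 ≤ jb x := by
  unfold jb
  rw [Real.one_le_sqrt]
  nlinarith [sq_nonneg ‖x‖]

lemma jb_pos {E : Type*} [NormedAddCommGroup E] (x : E) : 0 < jb x :=
  lt_of_lt_of_le one_pos (jb_one_le x)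

lemma jb_sq {E : Type*} [NormedAddCommGroup E] (x : E) : jb x ^ 2 = 1 + ‖x‖ ^ 2 :=
  Real.sq_sqrt (by positivity)

lemma norm_le_jb {E : Type*} [NormedAddCommGroup E] (x : E) : ‖x‖ ≤ jb x := by
  apply Real.le_sqrt_of_sq_le; linarith

lemma rpow_q {E : Type*} [NormedAddCommGroup E] (x : E) (r : ℝ) :
    (1 + ‖x‖ ^ 2) ^ (r / 2) = jb x ^ r := by
  rw [← jb_sq, ← Real.rpow_natCast, ← Real.rpow_mul (jb_pos x).le]
  congr 1; push_cast; ring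

section quad
variable {E : Type*} [NormedAddCommGroup E] [InnerProductSpace ℝ E]

lemma quad_bound (x : E) (n : ℕ) (hn : 1 ≤ n) :
    ‖iteratedFDeriv ℝ n (fun y : E => (jb x ^ 2)⁻¹ * (1 + ‖y‖ ^ 2)) x‖ ≤ (2 * (jb x)⁻¹) ^ n := by
  have hj := jb_pos x
  have hfd : fderiv ℝ (fun y : E => (jb x ^ 2)⁻¹ * (1 + ‖y‖ ^ 2))
      = fun y => ((jb x ^ 2)⁻¹ • (2 • (innerSL ℝ (E := E)))) y := by
    funext y
    have h1 : HasFDerivAt (fun y : E => ‖y‖ ^ 2) (2 • innerSL ℝ y) y :=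
      (hasStrictFDerivAt_norm_sq y).hasFDerivAt
    have := ((h1.const_add 1).const_mul ((jb x ^ 2)⁻¹)).fderiv
    rw [this]; rfl
  obtain ⟨k, rfl⟩ : ∃ k, n = k + 1 := ⟨n - 1, by omega⟩
  rw [← norm_iteratedFDeriv_fderiv, hfd]
  have hnorm : ‖(jb x ^ 2)⁻¹ • (2 • (innerSL ℝ (E := E)))‖ ≤ 2 * (jb x ^ 2)⁻¹ := by
    apply ContinuousLinearMap.opNorm_le_bound _ (by positivity)
    intro y
    simp only [smul_apply, norm_smul]
    rw [← Nat.cast_smul_eq_nsmul ℝ, norm_smul, innerSL_apply_norm]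
    rw [Real.norm_of_nonneg (by positivity)]
    simp; linarith
  set L := (jb x ^ 2)⁻¹ • (2 • (innerSL ℝ (E := E))) with hL
  rcases k with _ | k
  · rw [norm_iteratedFDeriv_zero]
    calc ‖L x‖ ≤ ‖L‖ * ‖x‖ := L.le_opNorm x
      _ ≤ (2 * (jb x ^ 2)⁻¹) * jb x := by gcongr; exact norm_le_jb x
      _ = _ := by rw [zero_add, pow_one]; field_simp
  rw [← norm_iteratedFDeriv_fderiv]
  have : fderiv ℝ (fun y => L y) = fun _ => L := by
    funext y; exact L.fderiv
  rw [this]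
  rcases k with _ | k
  · rw [norm_iteratedFDeriv_zero]
    refine hnorm.trans ?_
    simp only [zero_add, Nat.reduceAdd]
    rw [mul_pow, inv_pow]
    gcongr; norm_num
  · rw [iteratedFDeriv_const_of_ne (by omega)]
    simp; positivity

lemma scaled_bound (h : ℝ → ℝ) (hh : ContDiffOn ℝ (⊤ : ℕ∞) h (Set.Ioi 0)) (n : ℕ) :
    ∃ C > 0, ∀ x : E, ‖iteratedFDeriv ℝ n (fun y : E => h ((jb x ^ 2)⁻¹ * (1 + ‖y‖ ^ 2))) x‖
      ≤ C * jb x ^ (-(n : ℝ)) := by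
  set M : ℝ := 1 + ∑ i ∈ Finset.range (n + 1), ‖iteratedFDerivWithin ℝ i h (Set.Ioi 0) 1‖ with hM
  have hM0 : 0 < M := by positivity
  refine ⟨n.factorial * M * 2 ^ n, by positivity, fun x => ?_⟩
  have hj := jb_pos x
  have h1 : (jb x ^ 2)⁻¹ * (1 + ‖x‖ ^ 2) = 1 := by
    rw [← jb_sq]; field_simp
  have := norm_iteratedFDeriv_comp_le' (𝕜 := ℝ) (g := h) (n := n) (N := (⊤ : ℕ∞)) (t := Set.Ioi 0)
    (f := fun y : E => (jb x ^ 2)⁻¹ * (1 + ‖y‖ ^ 2)) (C := M) (D := 2 * (jb x)⁻¹)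
    (by rintro _ ⟨y, rfl⟩; simp only [Set.mem_Ioi]; positivity) (uniqueDiffOn_Ioi 0) hh
    (contDiff_const.mul (contDiff_const.add (contDiff_norm_sq ℝ))) (mod_cast le_top) x
    (by
      intro i hi
      simp only [h1]
      have := Finset.single_le_sum (f := fun i => ‖iteratedFDerivWithin ℝ i h (Set.Ioi 0) 1‖)
        (fun i _ => norm_nonneg _) (Finset.mem_range.2 (Nat.lt_succ_of_le hi))
      linarith)
    (fun i hi _ => quad_bound x i hi)
  refine this.trans (le_of_eq ?_)
  rw [Real.rpow_neg hj.le, Real.rpow_natCast, mul_pow, inv_pow]; ring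

lemma rpow_contDiff (s : ℝ) : ContDiff ℝ (⊤ : ℕ∞) (fun y : E => (1 + ‖y‖ ^ 2) ^ s) := by
  rw [contDiff_iff_contDiffAt]
  intro x
  exact (contDiff_const.add (contDiff_norm_sq ℝ)).contDiffAt.rpow_const_of_ne (by positivity)

lemma log_contDiff : ContDiff ℝ (⊤ : ℕ∞) (fun y : E => Real.log (1 + ‖y‖ ^ 2)) := by
  exact (contDiff_const.add (contDiff_norm_sq ℝ)).log (fun x => by positivity)

lemma rpow_bound (s : ℝ) (n : ℕ) :
    ∃ C > 0, ∀ x : E, ‖iteratedFDeriv ℝ n (fun y : E => (1 + ‖y‖ ^ 2) ^ (s / 2)) x‖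
      ≤ C * jb x ^ (s - (n : ℝ)) := by
  have hh : ContDiffOn ℝ (⊤ : ℕ∞) (fun t : ℝ => t ^ (s / 2)) (Set.Ioi 0) := by
    intro t ht
    exact (Real.contDiffAt_rpow_const_of_ne (ne_of_gt ht)).contDiffWithinAt
  obtain ⟨C, hC, hb⟩ := scaled_bound (E := E) _ hh n
  refine ⟨C, hC, fun x => ?_⟩
  have hj := jb_pos x
  have e : (fun y : E => (1 + ‖y‖ ^ 2) ^ (s / 2)) =
      fun y : E => (jb x ^ s) • (((jb x ^ 2)⁻¹ * (1 + ‖y‖ ^ 2)) ^ (s / 2)) := by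
    funext y
    rw [Real.mul_rpow (by positivity) (by positivity), Real.inv_rpow (by positivity), jb_sq,
      rpow_q, rpow_q]
    have := Real.rpow_pos_of_pos hj s
    simp only [smul_eq_mul]
    field_simp
  have hc : ContDiff ℝ (⊤ : ℕ∞) (fun y : E => ((jb x ^ 2)⁻¹ * (1 + ‖y‖ ^ 2)) ^ (s / 2)) := by
    rw [contDiff_iff_contDiffAt]
    intro y
    exact (contDiff_const.mul
      (contDiff_const.add (contDiff_norm_sq ℝ))).contDiffAt.rpow_const_of_ne (by positivity)
  rw [e, iteratedFDeriv_const_smul_apply' (hc.contDiffAt.of_le (mod_cast le_top)), norm_smul,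
    Real.norm_of_nonneg (by positivity), sub_eq_add_neg, Real.rpow_add hj]
  have := mul_le_mul_of_nonneg_left (hb x) (Real.rpow_nonneg hj.le s)
  linarith

lemma log_bound (n : ℕ) (hn : n ≠ 0) :
    ∃ C > 0, ∀ x : E, ‖iteratedFDeriv ℝ n (fun y : E => Real.log (1 + ‖y‖ ^ 2)) x‖
      ≤ C * jb x ^ (- (n : ℝ)) := by
  have hh : ContDiffOn ℝ (⊤ : ℕ∞) Real.log (Set.Ioi 0) := by
    intro t ht
    exact (Real.contDiffAt_log.2 (ne_of_gt ht)).contDiffWithinAt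
  obtain ⟨C, hC, hb⟩ := scaled_bound (E := E) _ hh n
  refine ⟨C, hC, fun x => ?_⟩
  have hj := jb_pos x
  have e : (fun y : E => Real.log (1 + ‖y‖ ^ 2)) =
      (fun y : E => Real.log ((jb x ^ 2)⁻¹ * (1 + ‖y‖ ^ 2))) + (fun _ => Real.log (jb x ^ 2)) := by
    funext y
    simp only [Pi.add_apply]
    rw [Real.log_mul (by positivity) (by positivity), Real.log_inv]
    ring
  have hc : ContDiff ℝ (⊤ : ℕ∞) (fun y : E => Real.log ((jb x ^ 2)⁻¹ * (1 + ‖y‖ ^ 2))) :=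
    (contDiff_const.mul (contDiff_const.add (contDiff_norm_sq ℝ))).log (fun x => by positivity)
  rw [e, iteratedFDeriv_add_apply (hc.contDiffAt.of_le (mod_cast le_top)) contDiffAt_const,
    iteratedFDeriv_const_of_ne hn]
  simpa using hb x

end quad

/-- Symbol class of order `a` on `S`, with arbitrarily small losses. -/
structure SymG {E : Type*} [NormedAddCommGroup E] [NormedSpace ℝ E] (S : Set E) (a : ℝ)
    (f : E → ℝ) : Prop where
  smooth : ContDiff ℝ (⊤ : ℕ∞) f
  bound : ∀ n : ℕ, ∀ ε > 0, ∃ C > 0, ∀ x ∈ S, ‖iteratedFDeriv ℝ n f x‖ ≤ C * jb x ^ (a - n + ε)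

section sym
variable {E : Type*} [NormedAddCommGroup E] [NormedSpace ℝ E] {S : Set E}

lemma SymG.mul {a b : ℝ} {f g : E → ℝ} (hf : SymG S a f) (hg : SymG S b g) :
    SymG S (a + b) (fun x => f x * g x) := by
  refine ⟨hf.smooth.mul hg.smooth, fun n ε hε => ?_⟩
  choose C hC hCb using fun i => hf.bound i (ε / 2) (by positivity)
  choose D hD hDb using fun i => hg.bound i (ε / 2) (by positivity)
  refine ⟨1 + ∑ i ∈ Finset.range (n + 1), (n.choose i : ℝ) * C i * D (n - i), ?_, fun x hx => ?_⟩
  · have : 0 ≤ ∑ i ∈ Finset.range (n + 1), (n.choose i : ℝ) * C i * D (n - i) :=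
      Finset.sum_nonneg fun i _ => by
        have := hC i; have := hD (n - i); positivity
    linarith
  have hj := jb_pos x
  refine (norm_iteratedFDeriv_mul_le hf.smooth hg.smooth x (n := n) (mod_cast le_top)).trans ?_
  have hp := Real.rpow_nonneg hj.le (a + b - n + ε)
  calc _ ≤ ∑ i ∈ Finset.range (n + 1),
        (n.choose i : ℝ) * C i * D (n - i) * jb x ^ (a + b - n + ε) := by
        apply Finset.sum_le_sum
        intro i hi
        have hi' : i ≤ n := Nat.lt_succ_iff.1 (Finset.mem_range.1 hi)
        have e : jb x ^ (a + b - n + ε) =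
            jb x ^ (a - i + ε / 2) * jb x ^ (b - (n - i : ℕ) + ε / 2) := by
          rw [← Real.rpow_add hj]; congr 1; push_cast [Nat.cast_sub hi']; ring
        rw [e]
        have h0 := hC i
        calc _ ≤ (n.choose i : ℝ) * (C i * jb x ^ (a - i + ε / 2)) *
              (D (n - i) * jb x ^ (b - (n - i : ℕ) + ε / 2)) := by
              gcongr
              · exact hCb i x hx
              · exact hDb (n - i) x hx
          _ = _ := by ring
    _ ≤ _ := by rw [← Finset.sum_mul]; nlinarith

lemma SymG.comp {χ : ℝ → ℝ} (hχ : ContDiff ℝ (⊤ : ℕ∞) χ)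
    (hb : ∀ n : ℕ, ∃ C > 0, ∀ t, ‖iteratedFDeriv ℝ n χ t‖ ≤ C)
    {u : E → ℝ} (hu : SymG S 0 u) : SymG S 0 (fun x => χ (u x)) := by
  refine ⟨hχ.comp hu.smooth, fun n ε hε => ?_⟩
  choose A hA hAb using hb
  set δ : ℝ := ε / (n + 1) with hδ
  have hδ0 : 0 < δ := by positivity
  have hnδ : n * δ ≤ ε := by
    rw [hδ, mul_div_assoc', div_le_iff₀ (by positivity)]; nlinarith
  choose C hC hCb using fun i => hu.bound i δ hδ0
  set M : ℝ := 1 + ∑ i ∈ Finset.range (n + 1), C i with hM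
  have hM1 : 1 ≤ M := by
    have : 0 ≤ ∑ i ∈ Finset.range (n + 1), C i := Finset.sum_nonneg fun i _ => (hC i).le
    linarith
  set B : ℝ := ∑ i ∈ Finset.range (n + 1), A i with hB
  have hB0 : 0 < B := Finset.sum_pos (fun i _ => hA i) ⟨0, by simp⟩
  refine ⟨n.factorial * B * M ^ n, by positivity, fun x hx => ?_⟩
  have hj := jb_pos x
  have hj1 := jb_one_le x
  have := norm_iteratedFDeriv_comp_le (𝕜 := ℝ) (g := χ) (f := u) (n := n) hχ hu.smooth
    (mod_cast le_top) x (C := B) (D := M * jb x ^ (-1 + δ))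
    (fun i hi => (hAb i _).trans (Finset.single_le_sum (f := A) (fun i _ => (hA i).le)
        (Finset.mem_range.2 (Nat.lt_succ_of_le hi))))
    (by
      intro i hi1 hi
      refine (hCb i x hx).trans ?_
      have hi1' : (1 : ℝ) ≤ i := by exact_mod_cast hi1
      rw [mul_pow, ← Real.rpow_natCast (jb x ^ (-1 + δ)), ← Real.rpow_mul hj.le]
      have h1 : C i ≤ ∑ i ∈ Finset.range (n + 1), C i :=
        Finset.single_le_sum (f := C) (fun i _ => (hC i).le)
        (Finset.mem_range.2 (Nat.lt_succ_of_le hi))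
      have h2 : C i ≤ M ^ i := by
        calc C i ≤ M := by linarith
          _ = M ^ 1 := (pow_one M).symm
          _ ≤ M ^ i := pow_le_pow_right₀ hM1 hi1
      gcongr
      nlinarith)
  refine this.trans ?_
  rw [mul_pow, ← Real.rpow_natCast (jb x ^ (-1 + δ)), ← Real.rpow_mul hj.le, ← mul_assoc]
  gcongr
  nlinarith

lemma cutoff_bound [ProperSpace E] {f : E → ℝ} (hf : ContDiff ℝ (⊤ : ℕ∞) f) {K : Set E}
    (hK : IsCompact K) (hc : ∀ x ∉ K, ∃ c : ℝ, |c| ≤ 1 ∧ f =ᶠ[𝓝 x] fun _ => c) (n : ℕ) :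
    ∃ C > 0, ∀ x, ‖iteratedFDeriv ℝ n f x‖ ≤ C * jb x ^ (-(n : ℝ)) := by
  have hcont : Continuous fun x => ‖iteratedFDeriv ℝ n f x‖ * jb x ^ n := by
    have := hf.continuous_iteratedFDeriv (m := n) (mod_cast le_top)
    unfold jb
    fun_prop
  obtain ⟨M, hM⟩ := hK.bddAbove_image hcont.continuousOn
  refine ⟨1 + |M|, by positivity, fun x => ?_⟩
  have hj := jb_pos x
  rw [Real.rpow_neg hj.le, Real.rpow_natCast, ← div_eq_mul_inv, le_div_iff₀ (by positivity)]
  by_cases hx : x ∈ K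
  · have := hM (Set.mem_image_of_mem _ hx)
    linarith [le_abs_self M]
  · obtain ⟨c, hc1, hc⟩ := hc x hx
    rw [(hc.iteratedFDeriv ℝ n).eq_of_nhds]
    rcases n with _ | n
    · simp; linarith [abs_nonneg M]
    · rw [iteratedFDeriv_const_of_ne (by omega)]
      simp; positivity

lemma SymG.of_bound {a : ℝ} {f : E → ℝ} (hf : ContDiff ℝ (⊤ : ℕ∞) f)
    (h : ∀ n : ℕ, ∃ C > 0, ∀ x, ‖iteratedFDeriv ℝ n f x‖ ≤ C * jb x ^ (a - (n : ℝ))) :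
    SymG S a f := by
  refine ⟨hf, fun n ε hε => ?_⟩
  obtain ⟨C, hC, hb⟩ := h n
  refine ⟨C, hC, fun x _ => (hb x).trans ?_⟩
  gcongr
  · exact jb_one_le x
  · linarith
end sym

lemma log_sym {E : Type*} [NormedAddCommGroup E] [InnerProductSpace ℝ E] {S : Set E} :
    SymG S 0 (fun y : E => Real.log (1 + ‖y‖ ^ 2)) := by
  refine ⟨log_contDiff, fun n ε hε => ?_⟩
  by_cases hn : n = 0
  · subst hn
    refine ⟨2 * (1 / ε), by positivity, fun x _ => ?_⟩
    have hj := jb_one_le x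
    rw [norm_iteratedFDeriv_zero, ← jb_sq, Real.norm_of_nonneg (Real.log_nonneg (by nlinarith)),
      Real.log_pow]
    have := Real.log_le_rpow_div (jb_pos x).le hε
    simp only [Nat.cast_zero, sub_zero, zero_add]
    push_cast
    rw [mul_assoc, one_div_mul_eq_div]
    linarith
  · obtain ⟨C, hC, hb⟩ := log_bound (E := E) n hn
    refine ⟨C, hC, fun x _ => (hb x).trans ?_⟩
    gcongr
    · exact jb_one_le x
    · linarith

section main
variable {m : ℕ}

lemma neg_pow_bound (P : Euc m →L[ℝ] Euc m) (r : ℝ) (hr : 0 ≤ r) (ε : ℝ) (hε : 0 < ε) :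
    ∃ C > 0, ∀ x : Euc m, jb x ≤ jb (P x) * Real.log (jb x) →
      jb (P x) ^ (-r) ≤ C * jb x ^ (-r + ε) := by
  set δ : ℝ := ε / (r + 1) with hδ
  have hδ0 : 0 < δ := by positivity
  have hnδ : δ * r ≤ ε := by
    rw [hδ, div_mul_eq_mul_div, div_le_iff₀ (by positivity)]; nlinarith
  refine ⟨(1 / δ) ^ r, by positivity, fun x hx => ?_⟩
  have hj := jb_pos x
  have hjP := jb_pos (P x)
  have h1 : jb x ≤ jb (P x) * (jb x ^ δ * (1 / δ)) := by
    refine hx.trans ?_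
    gcongr
    rw [mul_one_div]
    exact Real.log_le_rpow_div hj.le hδ0
  have h2 := Real.rpow_le_rpow hj.le h1 hr
  rw [Real.mul_rpow hjP.le (by positivity), Real.mul_rpow (by positivity) (by positivity),
    ← Real.rpow_mul hj.le] at h2
  have h3 : jb x ^ (δ * r) ≤ jb x ^ ε :=
    Real.rpow_le_rpow_of_exponent_le (jb_one_le x) hnδ
  rw [Real.rpow_add hj, Real.rpow_neg hj.le, Real.rpow_neg hjP.le]
  have a1 := Real.rpow_pos_of_pos hj r
  have a2 := Real.rpow_pos_of_pos hjP r
  rw [inv_le_iff_one_le_mul₀ a2]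
  have h4 : jb x ^ r ≤ jb (P x) ^ r * (jb x ^ ε * (1 / δ) ^ r) := h2.trans (by gcongr)
  calc (1 : ℝ) = (jb x ^ r)⁻¹ * jb x ^ r := by field_simp
    _ ≤ (jb x ^ r)⁻¹ * (jb (P x) ^ r * (jb x ^ ε * (1 / δ) ^ r)) := by gcongr
    _ = _ := by ring

lemma comp_P_bound (P : Euc m →L[ℝ] Euc m) (n : ℕ) :
    ∃ C > 0, ∀ x : Euc m, ‖iteratedFDeriv ℝ n (fun y => (1 + ‖P y‖ ^ 2) ^ ((1 : ℝ) / 2)) x‖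
      ≤ C * jb (P x) ^ (1 - (n : ℝ)) := by
  obtain ⟨C, hC, hb⟩ := rpow_bound (E := Euc m) 1 n
  refine ⟨C * (1 + ‖P‖) ^ n, by positivity, fun x => ?_⟩
  have := P.iteratedFDeriv_comp_right (rpow_contDiff (E := Euc m) (1 / 2)) x (i := n)
    (mod_cast le_top)
  have e : (fun y => (1 + ‖P y‖ ^ 2) ^ ((1 : ℝ) / 2)) =
    (fun y : Euc m => (1 + ‖y‖ ^ 2) ^ ((1 : ℝ) / 2)) ∘ P := rfl
  rw [e, this]
  refine (ContinuousMultilinearMap.norm_compContinuousLinearMap_le _ _).trans ?_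
  simp only [Finset.prod_const, Finset.card_univ, Fintype.card_fin]
  calc _ ≤ (C * jb (P x) ^ (1 - (n : ℝ))) * (1 + ‖P‖) ^ n := by
        gcongr
        · have := Real.rpow_pos_of_pos (jb_pos (P x)) (1 - (n : ℝ)); positivity
        · exact hb (P x)
        · linarith
    _ = _ := by ring

end main

/-- the logarithmically cut-off modification
`f_K(x) = W(x) χ₀(⟨Px⟩ log⟨x⟩/⟨x⟩) χ₀(|x|/K)` of a potential `W` that has
symbol-type decay of order `μ` only in the directions `Px` is, for `K` large,
a smooth function with full symbol-type decay of any order `μ₀ < μ`. -/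
theorem stmt2 (m : ℕ) (μ : ℝ) (hμ0 : 0 < μ) (hμ1 : μ ≤ 1)
    (P : Euc m →L[ℝ] Euc m) (hPproj : ∀ x, P (P x) = P x)
    (hPsa : ∀ x y : Euc m, ⟪P x, y⟫ = ⟪x, P y⟫)
    (W : Euc m → ℝ) (hW : ContDiff ℝ (⊤ : ℕ∞) W)
    (hWb : ∀ i : ℕ, ∃ C > 0, ∀ x : Euc m,
      ‖iteratedFDeriv ℝ i W x‖ ≤ C * (1 + ‖P x‖ ^ 2) ^ ((-μ - (i : ℝ)) / 2))
    (χ₀ : ℝ → ℝ) (hχ : ContDiff ℝ (⊤ : ℕ∞) χ₀)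
    (hχ0 : ∀ t : ℝ, t < 1 → χ₀ t = 0) (hχ1 : ∀ t : ℝ, 2 < t → χ₀ t = 1)
    (μ₀ : ℝ) (hμ₀0 : 0 < μ₀) (hμ₀1 : μ₀ < μ) :
    ∃ K > 0,
      ContDiff ℝ (⊤ : ℕ∞) (fun x : Euc m => W x *
          χ₀ (Real.sqrt (1 + ‖P x‖ ^ 2) * Real.log (Real.sqrt (1 + ‖x‖ ^ 2)) /
              Real.sqrt (1 + ‖x‖ ^ 2)) *
          χ₀ (‖x‖ / K)) ∧
      ∀ i : ℕ, ∃ C' > 0, ∀ x : Euc m,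
        ‖iteratedFDeriv ℝ i (fun x : Euc m => W x *
            χ₀ (Real.sqrt (1 + ‖P x‖ ^ 2) * Real.log (Real.sqrt (1 + ‖x‖ ^ 2)) /
                Real.sqrt (1 + ‖x‖ ^ 2)) *
            χ₀ (‖x‖ / K)) x‖ ≤ C' * (1 + ‖x‖) ^ (-μ₀ - (i : ℝ)) := by
  refine ⟨1, one_pos, ?_⟩
  set S : Set (Euc m) := {x | jb x ≤ jb (P x) * Real.log (jb x)} with hS
  set u : Euc m → ℝ := fun x => Real.sqrt (1 + ‖P x‖ ^ 2) *
    Real.log (Real.sqrt (1 + ‖x‖ ^ 2)) / Real.sqrt (1 + ‖x‖ ^ 2) with hu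
  have hPle : ∀ x, ‖P x‖ ≤ ‖x‖ := by
    intro x
    have h1 : ‖P x‖ ^ 2 ≤ ‖x‖ * ‖P x‖ := by
      rw [← real_inner_self_eq_norm_sq, hPsa, hPproj]
      exact real_inner_le_norm _ _
    by_contra hlt
    push Not at hlt
    nlinarith [norm_nonneg x]
  have hjP : ∀ x, jb (P x) ≤ jb x := by
    intro x; unfold jb; gcongr; exact hPle x
  -- symbols
  have sW : SymG S (-μ) W := by
    refine ⟨hW, fun n ε hε => ?_⟩
    obtain ⟨C, hC, hb⟩ := hWb n
    obtain ⟨D, hD, hDb⟩ := neg_pow_bound P (μ + n) (by positivity) ε hε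
    refine ⟨C * D, by positivity, fun x hx => (hb x).trans ?_⟩
    rw [rpow_q, mul_assoc]
    have := hDb x hx
    have e : -(μ + (n : ℝ)) = -μ - n := by ring
    rw [e] at this
    gcongr
  have sP : SymG S 1 (fun y => (1 + ‖P y‖ ^ 2) ^ ((1 : ℝ) / 2)) := by
    refine ⟨(rpow_contDiff (E := Euc m) (1 / 2)).comp P.contDiff, fun n ε hε => ?_⟩
    obtain ⟨C, hC, hb⟩ := comp_P_bound P n
    rcases n with _ | n
    · refine ⟨C, hC, fun x _ => (hb x).trans ?_⟩
      have h1 := hjP x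
      simp only [Nat.cast_zero, sub_zero, Real.rpow_one]
      gcongr
      refine h1.trans ?_
      calc jb x = jb x ^ (1 : ℝ) := (Real.rpow_one _).symm
        _ ≤ _ := Real.rpow_le_rpow_of_exponent_le (jb_one_le x) (by linarith)
    · obtain ⟨D, hD, hDb⟩ := neg_pow_bound P n (by positivity) ε hε
      refine ⟨C * D, by positivity, fun x hx => (hb x).trans ?_⟩
      rw [mul_assoc]
      have := hDb x hx
      have e : 1 - ((n + 1 : ℕ) : ℝ) = -n := by push_cast; ring
      rw [e]
      gcongr
  have sI : SymG S (-1) (fun y : Euc m => (1 + ‖y‖ ^ 2) ^ ((-1 : ℝ) / 2)) :=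
    SymG.of_bound (rpow_contDiff _) (rpow_bound (-1))
  have sc : SymG S 0 (fun _ : Euc m => (1 / 2 : ℝ)) := by
    refine SymG.of_bound contDiff_const fun n => ?_
    obtain ⟨C, hC, hb⟩ := cutoff_bound (E := Euc m) (f := fun _ => (1 / 2 : ℝ)) contDiff_const
      (K := ∅) isCompact_empty
      (fun x _ => ⟨1 / 2, by norm_num [abs_le], Eventually.of_forall fun _ => rfl⟩) n
    exact ⟨C, hC, fun x => by simpa using hb x⟩
  have su : SymG S 0 u := by
    have h := ((sP.mul log_sym).mul sI).mul sc
    have e : u = fun x => (1 + ‖P x‖ ^ 2) ^ ((1 : ℝ) / 2) * Real.log (1 + ‖x‖ ^ 2) *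
        (1 + ‖x‖ ^ 2) ^ ((-1 : ℝ) / 2) * (1 / 2) := by
      funext x
      rw [hu]
      simp only
      rw [rpow_q x (-1), Real.rpow_neg_one, ← Real.sqrt_eq_rpow, Real.log_sqrt (by positivity)]
      unfold jb
      ring
    rw [e]
    convert h using 1
    norm_num
  have hχK : ∀ t : ℝ, t ∉ Set.Icc (0 : ℝ) 3 → ∃ c : ℝ, |c| ≤ 1 ∧ χ₀ =ᶠ[𝓝 t] fun _ => c := by
    intro t ht
    by_cases h : t < 0
    · refine ⟨0, by simp, ?_⟩
      filter_upwards [gt_mem_nhds (show t < 1 by linarith)] with s hs using hχ0 s hs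
    · have : 2 < t := by
        by_contra h'
        exact ht ⟨by linarith, by linarith⟩
      refine ⟨1, by simp, ?_⟩
      filter_upwards [lt_mem_nhds this] with s hs using hχ1 s hs
  have hχb : ∀ n : ℕ, ∃ C > 0, ∀ t, ‖iteratedFDeriv ℝ n χ₀ t‖ ≤ C := by
    intro n
    obtain ⟨C, hC, hb⟩ := cutoff_bound hχ isCompact_Icc hχK n
    refine ⟨C, hC, fun t => (hb t).trans ?_⟩
    have := Real.rpow_le_one_of_one_le_of_nonpos (jb_one_le t)
      (show -(n : ℝ) ≤ 0 by simp)
    nlinarith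
  have sχu : SymG S 0 (fun x => χ₀ (u x)) := SymG.comp hχ hχb su
  have hvs : ContDiff ℝ (⊤ : ℕ∞) (fun x : Euc m => χ₀ (‖x‖ / 1)) := by
    rw [contDiff_iff_contDiffAt]
    intro x
    by_cases hx : x = 0
    · have : (fun x : Euc m => χ₀ (‖x‖ / 1)) =ᶠ[𝓝 x] fun _ => 0 := by
        filter_upwards [continuous_norm.continuousAt.eventually_lt
          (continuousAt_const (y := (1 : ℝ))) (by simp [hx])] with y hy
        exact hχ0 _ (by simpa using hy)
      exact contDiffAt_const.congr_of_eventuallyEq this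
    · exact hχ.contDiffAt.comp x ((contDiffAt_norm ℝ hx).div_const 1)
  have sv : SymG S 0 (fun x : Euc m => χ₀ (‖x‖ / 1)) := by
    refine SymG.of_bound hvs fun n => ?_
    obtain ⟨C, hC, hb⟩ := cutoff_bound hvs (isCompact_closedBall (0 : Euc m) 2)
      (fun x hx => by
        refine ⟨1, by simp, ?_⟩
        have hx' : 2 < ‖x‖ := by simpa using hx
        filter_upwards [(continuousAt_const (y := (2 : ℝ))).eventually_lt
          continuous_norm.continuousAt hx'] with y hy
        exact hχ1 _ (by simpa using hy)) n
    exact ⟨C, hC, fun x => by simpa using hb x⟩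
  have sF := (sW.mul sχu).mul sv
  refine ⟨sF.smooth, fun i => ?_⟩
  obtain ⟨C, hC, hb⟩ := sF.bound i (μ - μ₀) (by linarith)
  refine ⟨C * 2 ^ (μ₀ + i), by positivity, fun x => ?_⟩
  by_cases hx : x ∈ S
  · refine (hb x hx).trans ?_
    have e : -μ + 0 + 0 - (i : ℝ) + (μ - μ₀) = -(μ₀ + i) := by ring
    have e' : -μ₀ - (i : ℝ) = -(μ₀ + i) := by ring
    rw [e, e', mul_assoc]
    gcongr
    have h1 : 1 + ‖x‖ ≤ 2 * jb x := by linarith [jb_one_le x, norm_le_jb x]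
    have hj := jb_pos x
    have h2 : (1 + ‖x‖) ^ (μ₀ + i) ≤ 2 ^ (μ₀ + i) * jb x ^ (μ₀ + i) := by
      rw [← Real.mul_rpow (by norm_num) hj.le]
      exact Real.rpow_le_rpow (by positivity) h1 (by positivity)
    rw [Real.rpow_neg hj.le, Real.rpow_neg (by positivity), ← div_eq_mul_inv, le_div_iff₀
      (by positivity), inv_mul_le_iff₀ (by positivity)]
    linarith
  · have hux : u x < 1 := by
      have : jb (P x) * Real.log (jb x) < jb x := not_le.1 hx
      exact (div_lt_one (jb_pos x)).2 this
    have : (fun x : Euc m => W x * χ₀ (u x) * χ₀ (‖x‖ / 1)) =ᶠ[𝓝 x] fun _ => 0 := by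
      filter_upwards [su.smooth.continuous.continuousAt.eventually_lt
          (continuousAt_const (y := (1 : ℝ))) hux] with y hy
      rw [hχ0 _ hy]; simp
    rw [(this.iteratedFDeriv ℝ i).eq_of_nhds]
    simp only [iteratedFDeriv_fun_zero]
    simp
    positivity
end
end

section
/- Let n ∈ ℕ, μ ∈ (0,1], let V be a potential of long-range order μ on ℝ^n, let Y be an eikonal phase for V, and set K(x,λ) := √λ |x| − Y(x,λ). Then there exist functions x_+(ξ,t), λ_+(ξ,t) ∈ C^∞((ℝ^n∖{0}) × (0,∞)) and x_−(ξ,t), λ_−(ξ,t) ∈ C^∞((ℝ^n∖{0}) × (−∞,0)), with λ_± taking values in (0,∞), such that for every compact set A ⊂ ℝ^n∖{0} there exist T > 0 and C > 0 with the following properties for all ξ ∈ A and all t with ±t > T: ξ = ±∇_x K(x_±(ξ,t), λ_±(ξ,t)); t = ±∂_λ K(x_±(ξ,t), λ_±(ξ,t)); |x_±(ξ,t) − 2ξt| ≤ C(1+|t|)^{1-μ}; and |λ_±(ξ,t) − |ξ|²| ≤ C(1+|t|)^{-μ}. -/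
open MeasureTheory Metric Filter
open scoped ENNReal RealInnerProductSpace Topology

noncomputable section

/-- The Agmon–Hörmander dyadic shells: `Ω_0 = {|x| < 1}`,
`Ω_j = {2^(j-1) < |x| < 2^j}` for `j ≥ 1`. -/
def AHshell (n : ℕ) (j : ℕ) : Set (Euc n) :=
  if j = 0 then Metric.ball 0 1 else {x | (2:ℝ) ^ (j - 1) < ‖x‖ ∧ ‖x‖ < (2:ℝ) ^ j}

/-- The Agmon–Hörmander norm `‖u‖_{B*} = sup_j ρ_j^{-1/2} ‖u‖_{L²(Ω_j)}`,
valued in `ℝ≥0∞`. -/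
def BStarNorm (n : ℕ) (u : Euc n → ℂ) : ℝ≥0∞ :=
  ⨆ j : ℕ, (2 : ℝ≥0∞) ^ (-(j : ℝ) / 2) * eLpNorm u 2 (volume.restrict (AHshell n j))

/-- A potential of long-range order `μ` on `ℝ^n`: smooth, with
`‖∂^γ V(x)‖ ≤ C (1+|x|)^{-μ-|γ|}` for every order of derivative. -/
def IsLongRangePotential (n : ℕ) (μ : ℝ) (V : Euc n → ℝ) : Prop :=
  ContDiff ℝ (⊤ : ℕ∞) V ∧
    ∀ i : ℕ, ∃ C > 0, ∀ x : Euc n, ‖iteratedFDeriv ℝ i V x‖ ≤ C * (1 + ‖x‖) ^ (-μ - (i : ℝ))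

/-- An eikonal phase `Y` for a long-range potential `V` of order `μ`:
smooth on `ℝ^n × (0,∞)`, solving `2√λ ∂_r Y = |∇_x Y|² + V` for `|x|` large
(locally uniformly in `λ`), with symbol-type bounds
`|∂_x^α ∂_λ^k Y| ≤ C (1+|x|)^{1-|α|-μ}`. -/
def IsEikonalPhase (n : ℕ) (μ : ℝ) (V : Euc n → ℝ) (Y : Euc n → ℝ → ℝ) : Prop :=
  ContDiffOn ℝ (⊤ : ℕ∞) (fun p : Euc n × ℝ => Y p.1 p.2) (Set.univ ×ˢ Set.Ioi 0) ∧
  (∀ Λ : Set ℝ, IsCompact Λ → Λ ⊆ Set.Ioi 0 → ∃ R₀ > 0, ∀ x : Euc n, ∀ lam ∈ Λ, R₀ < ‖x‖ →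
      2 * Real.sqrt lam * (⟪x, gradient (fun y => Y y lam) x⟫ / ‖x‖)
        = ‖gradient (fun y => Y y lam) x‖ ^ 2 + V x) ∧
  (∀ (a k : ℕ) (Λ : Set ℝ), IsCompact Λ → Λ ⊆ Set.Ioi 0 → ∃ C > 0,
      ∀ x : Euc n, ∀ lam ∈ Λ,
      ‖iteratedFDeriv ℝ a (fun y => iteratedDerivWithin k (fun l => Y y l) (Set.Ioi 0) lam) x‖
        ≤ C * (1 + ‖x‖) ^ (1 - (a : ℝ) - μ))

/-- `K(x,λ) = √λ |x| − Y(x,λ)`. -/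
def Kfun (n : ℕ) (Y : Euc n → ℝ → ℝ) (lam : ℝ) (x : Euc n) : ℝ :=
  Real.sqrt lam * ‖x‖ - Y x lam

section helpers
open scoped ContDiff

theorem h_fix {E : Type*} [NormedAddCommGroup E] [CompleteSpace E]
    (f : E → E) (c : E) (r : ℝ) (hr : 0 < r)
    (hmap : ∀ p ∈ closedBall c r, f p ∈ ball c r)
    (hlip : ∀ p ∈ closedBall c r, ∀ p' ∈ closedBall c r, ‖f p - f p'‖ ≤ 1/2 * ‖p - p'‖) :
    ∃ p ∈ ball c r, f p = p := by
  have hm : Set.MapsTo f (closedBall c r) (closedBall c r) :=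
    fun p hp => ball_subset_closedBall (hmap p hp)
  have hK : ContractingWith (1/2) (hm.restrict f _ _) := by
    refine ⟨by rw [← NNReal.coe_lt_coe]; norm_num, LipschitzWith.of_dist_le_mul ?_⟩
    rintro ⟨p, hp⟩ ⟨p', hp'⟩
    have := hlip p hp p' hp'
    simpa [Subtype.dist_eq, dist_eq_norm] using this
  obtain ⟨y, hy, hfy, -⟩ := hK.exists_fixedPoint' isClosed_closedBall.isComplete hm
    (mem_closedBall_self hr.le) (edist_ne_top _ _)
  exact ⟨y, hfy ▸ hmap y hy, hfy⟩

theorem h_param {F E : Type*} [NormedAddCommGroup E] [NormedSpace ℝ E] [CompleteSpace E]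
    [NormedAddCommGroup F] [NormedSpace ℝ F] [CompleteSpace F]
    (Φ : F × E → E) (U : Set F) (hU : IsOpen U) (c : F → E) (r : F → ℝ)
    (hc : ContinuousOn c U) (hr : ContinuousOn r U)
    (hr0 : ∀ q ∈ U, 0 < r q)
    (hsm : ∀ q ∈ U, ∀ p ∈ ball (c q) (r q), ContDiffAt ℝ ∞ Φ (q, p))
    (hmap : ∀ q ∈ U, ∀ p ∈ closedBall (c q) (r q), Φ (q, p) ∈ ball (c q) (r q))
    (hlip : ∀ q ∈ U, ∀ p ∈ closedBall (c q) (r q), ∀ p' ∈ closedBall (c q) (r q),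
      ‖Φ (q, p) - Φ (q, p')‖ ≤ 1/2 * ‖p - p'‖) :
    ∃ s : F → E, ContDiffOn ℝ ∞ s U ∧
      ∀ q ∈ U, s q ∈ ball (c q) (r q) ∧ Φ (q, s q) = s q := by
  classical
  have hex : ∀ q, ∃ p, q ∈ U → p ∈ ball (c q) (r q) ∧ Φ (q, p) = p := by
    intro q
    by_cases hq : q ∈ U
    · obtain ⟨p, hp, hfp⟩ := h_fix (fun p => Φ (q, p)) (c q) (r q) (hr0 q hq) (hmap q hq) (hlip q hq)
      exact ⟨p, fun _ => ⟨hp, hfp⟩⟩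
    · exact ⟨0, fun h => absurd h hq⟩
  choose s hs using hex
  refine ⟨s, ?_, hs⟩
  intro q₀ hq₀
  apply ContDiffAt.contDiffWithinAt
  obtain ⟨hb, hfix⟩ := hs q₀ hq₀
  have cdΦ := hsm q₀ hq₀ _ hb
  set f : F × E → E := fun u => u.2 - Φ u with hf
  have cdf : ContDiffAt ℝ ∞ f (q₀, s q₀) := contDiffAt_snd.sub cdΦ
  have hdΦ : HasFDerivAt Φ (fderiv ℝ Φ (q₀, s q₀)) (q₀, s q₀) :=
    (cdΦ.differentiableAt (by simp)).hasFDerivAt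
  have hd2 : HasFDerivAt (fun p => Φ (q₀, p))
      (fderiv ℝ Φ (q₀, s q₀) ∘L .inr ℝ F E) (s q₀) := by
    have := hdΦ.comp (s q₀) (hasFDerivAt_prodMk_right q₀ (s q₀))
    exact this
  have hnorm : ‖fderiv ℝ Φ (q₀, s q₀) ∘L .inr ℝ F E‖ ≤ ((1/2 : NNReal) : ℝ) := by
    refine hd2.le_of_lipschitzOn (isOpen_ball.mem_nhds hb) ?_
    refine LipschitzOnWith.of_dist_le_mul ?_
    intro p hp p' hp'
    have := hlip q₀ hq₀ p (ball_subset_closedBall hp) p' (ball_subset_closedBall hp')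
    simpa [dist_eq_norm] using this
  have hfd : fderiv ℝ f (q₀, s q₀) ∘L .inr ℝ F E
      = 1 - fderiv ℝ Φ (q₀, s q₀) ∘L .inr ℝ F E := by
    have : HasFDerivAt f (ContinuousLinearMap.snd ℝ F E - fderiv ℝ Φ (q₀, s q₀)) (q₀, s q₀) :=
      hasFDerivAt_snd.sub hdΦ
    rw [this.fderiv]
    ext v
    simp
  have hinv : (fderiv ℝ f (q₀, s q₀) ∘L .inr ℝ F E).IsInvertible := by
    rw [hfd]
    have hu : IsUnit (1 - fderiv ℝ Φ (q₀, s q₀) ∘L .inr ℝ F E) := by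
      apply isUnit_one_sub_of_norm_lt_one
      refine lt_of_le_of_lt hnorm ?_
      norm_num
    obtain ⟨w, hw⟩ := hu
    exact ⟨ContinuousLinearEquiv.ofUnit w, by rw [← hw]; rfl⟩
  have hn : (∞ : WithTop ℕ∞) ≠ 0 := by simp
  have hψ := cdf.contDiffAt_implicitFunction hn hinv
  refine hψ.congr_of_eventuallyEq ?_
  have hψ0 := cdf.implicitFunction_apply_self hn hinv
  have he := cdf.eventually_apply_implicitFunction hn hinv
  have hfu : f (q₀, s q₀) = 0 := by simp [hf, hfix]
  have hnear : ∀ᶠ q in 𝓝 q₀, ‖cdf.implicitFunction hn hinv q - c q‖ < r q := by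
    have h1 : ContinuousAt (fun q => ‖cdf.implicitFunction hn hinv q - c q‖) q₀ :=
      (hψ.continuousAt.sub (hc.continuousAt (hU.mem_nhds hq₀))).norm
    refine h1.eventually_lt (hr.continuousAt (hU.mem_nhds hq₀)) ?_
    have : cdf.implicitFunction hn hinv q₀ = s q₀ := hψ0
    rw [this]
    simpa [dist_eq_norm] using hb
  filter_upwards [he, hnear, hU.mem_nhds hq₀] with q h1 h2 h3
  set p := cdf.implicitFunction hn hinv q
  rw [hfu] at h1
  have h1' : Φ (q, p) = p := by
    have : p - Φ (q, p) = 0 := h1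
    exact (sub_eq_zero.1 this).symm
  have hp : p ∈ ball (c q) (r q) := by simpa [dist_eq_norm] using h2
  have h5 := hlip q h3 (s q) (ball_subset_closedBall (hs q h3).1) p (ball_subset_closedBall hp)
  rw [h1', (hs q h3).2] at h5
  have : ‖s q - p‖ ≤ 0 := by linarith
  exact sub_eq_zero.1 (norm_le_zero_iff.1 this)

theorem h_chi (n : ℕ) (τ : Euc n → ℝ) (hτ : ContinuousOn τ {ξ : Euc n | ξ ≠ 0}) :
    ∃ χ : Euc n × ℝ → ℝ, ContDiffOn ℝ ∞ χ ({ξ : Euc n | ξ ≠ 0} ×ˢ Set.Ioi 0) ∧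
      (∀ p, 0 ≤ χ p ∧ χ p ≤ 1) ∧
      (∀ p ∈ ({ξ : Euc n | ξ ≠ 0} ×ˢ Set.Ioi (0:ℝ)), p.2 ≤ τ p.1 + 1 → χ p = 0) ∧
      (∀ p ∈ ({ξ : Euc n | ξ ≠ 0} ×ˢ Set.Ioi (0:ℝ)), τ p.1 + 2 ≤ p.2 → χ p = 1) := by
  set D : Set (Euc n × ℝ) := {ξ : Euc n | ξ ≠ 0} ×ˢ Set.Ioi (0:ℝ) with hD
  have hDo : IsOpen D := isOpen_ne.prod isOpen_Ioi
  have hτ' : ContinuousOn (fun p : Euc n × ℝ => τ p.1 - p.2) D :=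
    (hτ.comp continuousOn_fst (fun p hp => hp.1)).sub continuousOn_snd
  have ho0 : IsOpen (D ∩ (fun p : Euc n × ℝ => τ p.1 - p.2) ⁻¹' Set.Iio (-1)) :=
    hτ'.isOpen_inter_preimage hDo isOpen_Iio
  have ho1 : IsOpen (D ∩ (fun p : Euc n × ℝ => τ p.1 - p.2) ⁻¹' Set.Ioi (-2)) :=
    hτ'.isOpen_inter_preimage hDo isOpen_Ioi
  obtain ⟨f0, s0, c0, r0⟩ := ho0.exists_contDiff_support_eq (n := ⊤)
  obtain ⟨f1, s1, c1, r1⟩ := ho1.exists_contDiff_support_eq (n := ⊤)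
  have n0 : ∀ p, 0 ≤ f0 p := fun p => (r0 ⟨p, rfl⟩).1
  have n1 : ∀ p, 0 ≤ f1 p := fun p => (r1 ⟨p, rfl⟩).1
  have m0 : ∀ p, f0 p ≠ 0 ↔ (p ∈ D ∧ τ p.1 - p.2 < -1) := fun p => by
    rw [← Function.mem_support, s0]; rfl
  have m1 : ∀ p, f1 p ≠ 0 ↔ (p ∈ D ∧ -2 < τ p.1 - p.2) := fun p => by
    rw [← Function.mem_support, s1]; rfl
  have hne : ∀ p ∈ D, f0 p + f1 p ≠ 0 := by
    intro p hp h
    have h0 : f0 p = 0 := by linarith [n0 p, n1 p]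
    have h1 : f1 p = 0 := by linarith [n0 p, n1 p]
    have h0' := mt (m0 p).2 (by simpa using h0)
    have h1' := mt (m1 p).2 (by simpa using h1)
    simp only [hp, true_and, not_lt] at h0' h1'
    linarith
  refine ⟨fun p => f0 p / (f0 p + f1 p), ?_, ?_, ?_, ?_⟩
  · exact c0.contDiffOn.div (c0.add c1).contDiffOn hne
  · intro p
    exact ⟨div_nonneg (n0 p) (add_nonneg (n0 p) (n1 p)),
      div_le_one_of_le₀ (by linarith [n1 p]) (add_nonneg (n0 p) (n1 p))⟩
  · intro p hp h
    have : f0 p = 0 := by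
      by_contra h0
      have := ((m0 p).1 h0).2
      linarith
    simp [this]
  · intro p hp h
    have h1 : f1 p = 0 := by
      by_contra h0
      have := ((m1 p).1 h0).2
      linarith
    have h2 := hne p hp
    simp only [h1, add_zero] at h2 ⊢
    exact div_self h2

theorem h_tau (n : ℕ) (Good : Euc n → ℝ → Prop)
    (hG : ∀ A : Set (Euc n), IsCompact A → A ⊆ {ξ : Euc n | ξ ≠ 0} →
      ∃ T > 0, ∀ ξ ∈ A, ∀ t, T < t → Good ξ t) :
    ∃ τ : Euc n → ℝ, ContinuousOn τ {ξ : Euc n | ξ ≠ 0} ∧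
      ∀ ξ, ξ ≠ 0 → 0 ≤ τ ξ ∧ ∀ t, τ ξ < t → Good ξ t := by
  classical
  obtain ⟨g, hg⟩ := exists_continuous_forall_mem_convex_of_local_const
    (X := {ξ : Euc n // ξ ≠ 0}) (E := ℝ)
    (t := fun ξ => {c | 0 ≤ c ∧ ∀ t, c < t → Good ξ.1 t}) (by
      intro ξ
      apply Set.OrdConnected.convex
      refine ⟨?_⟩
      rintro a ⟨ha, ha'⟩ b ⟨hb, hb'⟩ c ⟨hc, hc'⟩
      exact ⟨ha.trans hc, fun t ht => ha' t (hc.trans_lt ht)⟩) (by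
      rintro ⟨ξ, hξ⟩
      obtain ⟨A, hA, hAs, hAc⟩ := local_compact_nhds
        (isOpen_ne.mem_nhds hξ : {ξ : Euc n | ξ ≠ 0} ∈ 𝓝 ξ)
      obtain ⟨T, hT, h⟩ := hG A hAc hAs
      refine ⟨T, ?_⟩
      have : ∀ᶠ y : {ξ : Euc n // ξ ≠ 0} in 𝓝 ⟨ξ, hξ⟩, y.1 ∈ A :=
        continuous_subtype_val.continuousAt.eventually hA
      filter_upwards [this] with y hy
      exact ⟨hT.le, fun t ht => h y.1 hy t ht⟩)
  refine ⟨fun ξ => if h : ξ ≠ 0 then g ⟨ξ, h⟩ else 0, ?_, ?_⟩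
  · rw [continuousOn_iff_continuous_domRestrict]
    refine g.continuous.congr ?_
    rintro ⟨ξ, hξ⟩
    have hξ' : ξ ≠ 0 := hξ
    show _ = dite _ _ _
    rw [dif_pos hξ']
  · intro ξ hξ
    simp only [hξ, ne_eq, not_false_eq_true, dite_true]
    exact hg ⟨ξ, hξ⟩

theorem h_glue (n : ℕ) {H : Type*} [NormedAddCommGroup H] [NormedSpace ℝ H]
    (τ : Euc n → ℝ) (hτ : ContinuousOn τ {ξ : Euc n | ξ ≠ 0}) (χ : Euc n × ℝ → ℝ)
    (hχ : ContDiffOn ℝ ∞ χ ({ξ : Euc n | ξ ≠ 0} ×ˢ Set.Ioi 0))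
    (hχ0 : ∀ p ∈ ({ξ : Euc n | ξ ≠ 0} ×ˢ Set.Ioi (0:ℝ)), p.2 ≤ τ p.1 + 1 → χ p = 0)
    (s d : Euc n × ℝ → H)
    (hs : ContDiffOn ℝ ∞ s {p | p.1 ≠ 0 ∧ 0 < p.2 ∧ τ p.1 < p.2})
    (hd : ContDiffOn ℝ ∞ d ({ξ : Euc n | ξ ≠ 0} ×ˢ Set.Ioi 0)) :
    ContDiffOn ℝ ∞ (fun p => χ p • s p + (1 - χ p) • d p)
      ({ξ : Euc n | ξ ≠ 0} ×ˢ Set.Ioi 0) := by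
  set D : Set (Euc n × ℝ) := {ξ : Euc n | ξ ≠ 0} ×ˢ Set.Ioi (0:ℝ) with hD
  have hDo : IsOpen D := isOpen_ne.prod isOpen_Ioi
  have hτ' : ContinuousOn (fun p : Euc n × ℝ => τ p.1 - p.2) D :=
    (hτ.comp continuousOn_fst (fun p hp => hp.1)).sub continuousOn_snd
  have hW : IsOpen {p : Euc n × ℝ | p.1 ≠ 0 ∧ 0 < p.2 ∧ τ p.1 < p.2} := by
    have := hτ'.isOpen_inter_preimage hDo (isOpen_Iio (a := 0))
    convert this using 1
    ext p
    simp [hD, and_assoc]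
  refine ContDiffOn.add ?_ ((contDiffOn_const.sub hχ).smul hd)
  intro p hp
  apply ContDiffAt.contDiffWithinAt
  by_cases h : τ p.1 < p.2
  · have hpW : p ∈ {p : Euc n × ℝ | p.1 ≠ 0 ∧ 0 < p.2 ∧ τ p.1 < p.2} := ⟨hp.1, hp.2, h⟩
    exact (hχ.contDiffAt (hDo.mem_nhds hp)).smul (hs.contDiffAt (hW.mem_nhds hpW))
  · have hev : ∀ᶠ q in 𝓝 p, χ q • s q = 0 := by
      have h1 : ∀ᶠ q in 𝓝 p, -1 < τ q.1 - q.2 :=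
        (hτ'.continuousAt (hDo.mem_nhds hp)).eventually (lt_mem_nhds (by linarith))
      filter_upwards [h1, hDo.mem_nhds hp] with q h1 h2
      rw [hχ0 q h2 (by linarith), zero_smul]
    exact (contDiffAt_const (c := (0:H))).congr_of_eventuallyEq hev

/-- gradient of Y in x -/
def hP (n : ℕ) (Y : Euc n → ℝ → ℝ) (p : Euc n × ℝ) : Euc n := gradient (fun y => Y y p.2) p.1

/-- derivative of Y in the energy -/
def hQ (n : ℕ) (Y : Euc n → ℝ → ℝ) (p : Euc n × ℝ) : ℝ := deriv (fun l => Y p.1 l) p.2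

theorem h_L (n : ℕ) : ∃ L : (Euc n →L[ℝ] ℝ) →L[ℝ] Euc n, (∀ v, ‖L v‖ = ‖v‖) ∧
    ∀ (g : Euc n → ℝ) x, gradient g x = L (fderiv ℝ g x) := by
  let T := (InnerProductSpace.toDual ℝ (Euc n)).symm
  refine ⟨AddMonoidHom.toRealLinearMap (T.toLinearEquiv.toAddEquiv.toAddMonoidHom) T.continuous, ?_, ?_⟩
  · intro v
    exact T.norm_map v
  · intro g x
    rfl

theorem h_cd {n : ℕ} {Y : Euc n → ℝ → ℝ}
    (hf : ContDiffOn ℝ ∞ (fun p : Euc n × ℝ => Y p.1 p.2) (Set.univ ×ˢ Set.Ioi 0)) (x : Euc n) (l : ℝ) (hl : 0 < l) :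
    ContDiffAt ℝ ∞ (fun p : Euc n × ℝ => Y p.1 p.2) (x, l) :=
  hf.contDiffAt ((isOpen_univ.prod isOpen_Ioi).mem_nhds ⟨trivial, hl⟩)

theorem h_fx {n : ℕ} {Y : Euc n → ℝ → ℝ}
    (hf : ContDiffOn ℝ ∞ (fun p : Euc n × ℝ => Y p.1 p.2) (Set.univ ×ˢ Set.Ioi 0)) (x : Euc n) (l : ℝ) (hl : 0 < l) :
    HasFDerivAt (fun y => Y y l)
      (fderiv ℝ (fun p : Euc n × ℝ => Y p.1 p.2) (x, l) ∘L .inl ℝ (Euc n) ℝ) x := by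
  have h := ((h_cd hf x l hl).differentiableAt (by simp)).hasFDerivAt
  exact h.comp x (hasFDerivAt_prodMk_left (𝕜 := ℝ) x l)

theorem h_fl {n : ℕ} {Y : Euc n → ℝ → ℝ}
    (hf : ContDiffOn ℝ ∞ (fun p : Euc n × ℝ => Y p.1 p.2) (Set.univ ×ˢ Set.Ioi 0)) (x : Euc n) (l : ℝ) (hl : 0 < l) :
    HasDerivAt (fun m => Y x m)
      (fderiv ℝ (fun p : Euc n × ℝ => Y p.1 p.2) (x, l) (0, 1)) l := by
  have h := ((h_cd hf x l hl).differentiableAt (by simp)).hasFDerivAt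
  have := (h.comp l (hasFDerivAt_prodMk_right (𝕜 := ℝ) x l)).hasDerivAt
  exact this

theorem h_fd {n : ℕ} {Y : Euc n → ℝ → ℝ}
    (hf : ContDiffOn ℝ ∞ (fun p : Euc n × ℝ => Y p.1 p.2) (Set.univ ×ˢ Set.Ioi 0)) : ContDiffOn ℝ ∞ (fderiv ℝ (fun p : Euc n × ℝ => Y p.1 p.2))
    (Set.univ ×ˢ Set.Ioi 0) :=
  hf.fderiv_of_isOpen (isOpen_univ.prod isOpen_Ioi) (by simp)

theorem h_Qeq {n : ℕ} {Y : Euc n → ℝ → ℝ}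
    (hf : ContDiffOn ℝ ∞ (fun p : Euc n × ℝ => Y p.1 p.2) (Set.univ ×ˢ Set.Ioi 0)) (x : Euc n) (l : ℝ) (hl : 0 < l) :
    hQ n Y (x, l) = fderiv ℝ (fun p : Euc n × ℝ => Y p.1 p.2) (x, l) (0, 1) :=
  (h_fl hf x l hl).deriv

theorem h_Qsm {n : ℕ} {Y : Euc n → ℝ → ℝ}
    (hf : ContDiffOn ℝ ∞ (fun p : Euc n × ℝ => Y p.1 p.2) (Set.univ ×ˢ Set.Ioi 0)) : ContDiffOn ℝ ∞ (hQ n Y) (Set.univ ×ˢ Set.Ioi 0) := by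
  refine ((h_fd hf).clm_apply (contDiffOn_const (c := ((0, 1) : Euc n × ℝ)))).congr ?_
  rintro ⟨x, l⟩ ⟨-, hl⟩
  exact h_Qeq hf x l hl

theorem h_Psm {n : ℕ} {Y : Euc n → ℝ → ℝ}
    (hf : ContDiffOn ℝ ∞ (fun p : Euc n × ℝ => Y p.1 p.2) (Set.univ ×ˢ Set.Ioi 0)) : ContDiffOn ℝ ∞ (hP n Y) (Set.univ ×ˢ Set.Ioi 0) := by
  obtain ⟨L, -, hL⟩ := h_L n
  have : ContDiffOn ℝ ∞ (fun p : Euc n × ℝ =>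
      L (fderiv ℝ (fun p : Euc n × ℝ => Y p.1 p.2) p ∘L .inl ℝ (Euc n) ℝ))
      (Set.univ ×ˢ Set.Ioi 0) :=
    L.contDiff.comp_contDiffOn ((h_fd hf).clm_comp contDiffOn_const)
  refine this.congr ?_
  rintro ⟨x, l⟩ ⟨-, hl⟩
  simp only [hP, hL]
  rw [(h_fx hf x l hl).fderiv]

/-- mixed derivative -/
theorem h_mixed {n : ℕ} {Y : Euc n → ℝ → ℝ}
    (hf : ContDiffOn ℝ ∞ (fun p : Euc n × ℝ => Y p.1 p.2) (Set.univ ×ˢ Set.Ioi 0)) (x : Euc n) (l : ℝ) (hl : 0 < l) :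
    HasDerivAt (fun m => fderiv ℝ (fun y => Y y m) x) (fderiv ℝ (fun y => hQ n Y (y, l)) x) l := by
  set f : Euc n × ℝ → ℝ := fun p => Y p.1 p.2 with hfdef
  have hfd : ContDiffAt ℝ ∞ (fderiv ℝ f) (x, l) :=
    (h_fd hf).contDiffAt ((isOpen_univ.prod isOpen_Ioi).mem_nhds ⟨trivial, hl⟩)
  have hD := (hfd.differentiableAt (by simp)).hasFDerivAt
  set D2 := fderiv ℝ (fderiv ℝ f) (x, l) with hD2
  have hsym : IsSymmSndFDerivAt ℝ f (x, l) := (h_cd hf x l hl).isSymmSndFDerivAt (by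
    simp only [minSmoothness_of_isRCLikeNormedField]; exact (WithTop.coe_le_coe.2 le_top : ((2 : ℕ∞) : WithTop ℕ∞) ≤ ((⊤ : ℕ∞) : WithTop ℕ∞)))
  -- derivative in x of Q
  have hQx : HasFDerivAt (fun y => hQ n Y (y, l))
      (((ContinuousLinearMap.apply ℝ ℝ ((0, 1) : Euc n × ℝ)) ∘L D2) ∘L .inl ℝ (Euc n) ℝ) x := by
    have h1 := ((ContinuousLinearMap.apply ℝ ℝ ((0, 1) : Euc n × ℝ)).hasFDerivAt.comp (x, l) hD).comp x
      (hasFDerivAt_prodMk_left (𝕜 := ℝ) x l)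
    refine h1.congr_of_eventuallyEq (Eventually.of_forall fun y => ?_)
    exact h_Qeq hf y l hl
  have h2 : HasDerivAt (fun m => fderiv ℝ f (x, m) ∘L .inl ℝ (Euc n) ℝ)
      (D2 (0, 1) ∘L .inl ℝ (Euc n) ℝ) l := by
    have h3 := ((hD.comp l (hasFDerivAt_prodMk_right (𝕜 := ℝ) x l))).hasDerivAt
    have h4 := (((ContinuousLinearMap.compL ℝ (Euc n) (Euc n × ℝ) ℝ).flip
      (.inl ℝ (Euc n) ℝ)).hasFDerivAt (x := fderiv ℝ f (x, l))).comp_hasDerivAt l h3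
    exact h4
  have h5 : D2 (0, 1) ∘L .inl ℝ (Euc n) ℝ = fderiv ℝ (fun y => hQ n Y (y, l)) x := by
    rw [hQx.fderiv]
    ext1 w
    simpa using hsym (0, 1) (w, 0)
  rw [← h5]
  refine h2.congr_of_eventuallyEq ?_
  filter_upwards [lt_mem_nhds hl] with m hm
  exact (h_fx hf x m hm).fderiv

theorem h_iter1 {n : ℕ} {Y : Euc n → ℝ → ℝ} (y : Euc n) (l : ℝ) (hl : 0 < l) :
    iteratedDerivWithin 1 (fun l => Y y l) (Set.Ioi 0) l = hQ n Y (y, l) := by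
  rw [iteratedDerivWithin_one, derivWithin_of_isOpen isOpen_Ioi hl]
  rfl

theorem h_iter2 {n : ℕ} {Y : Euc n → ℝ → ℝ} (y : Euc n) (l : ℝ) (hl : 0 < l) :
    iteratedDerivWithin 2 (fun l => Y y l) (Set.Ioi 0) l = deriv (fun m => hQ n Y (y, m)) l := by
  rw [iteratedDerivWithin_succ, derivWithin_of_isOpen isOpen_Ioi hl]
  apply EventuallyEq.deriv_eq
  filter_upwards [lt_mem_nhds hl] with m hm
  exact h_iter1 y m hm

theorem h_bounds {n : ℕ} {μ : ℝ} {V : Euc n → ℝ} {Y : Euc n → ℝ → ℝ}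
    (hY : IsEikonalPhase n μ V Y) (Λ : Set ℝ) (hΛ : IsCompact Λ) (hΛ0 : Λ ⊆ Set.Ioi 0) :
    ∃ C > 0, ∀ x : Euc n, ∀ l ∈ Λ,
      ‖hP n Y (x, l)‖ ≤ C * (1 + ‖x‖) ^ (-μ) ∧
      ‖hQ n Y (x, l)‖ ≤ C * (1 + ‖x‖) ^ (1 - μ) ∧
      (∃ A : Euc n →L[ℝ] Euc n, HasFDerivAt (fun y => hP n Y (y, l)) A x ∧ ‖A‖ ≤ C * (1 + ‖x‖) ^ (-1 - μ)) ∧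
      (∃ v, HasDerivAt (fun m => hP n Y (x, m)) v l ∧ ‖v‖ ≤ C * (1 + ‖x‖) ^ (-μ)) ∧
      (∃ A : Euc n →L[ℝ] ℝ, HasFDerivAt (fun y => hQ n Y (y, l)) A x ∧ ‖A‖ ≤ C * (1 + ‖x‖) ^ (-μ)) ∧
      (∃ v, HasDerivAt (fun m => hQ n Y (x, m)) v l ∧ ‖v‖ ≤ C * (1 + ‖x‖) ^ (1 - μ)) := by
  obtain ⟨hf, -, hB⟩ := hY
  obtain ⟨L, hLn, hL⟩ := h_L n
  obtain ⟨C10, p10, h10⟩ := hB 1 0 Λ hΛ hΛ0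
  obtain ⟨C01, p01, h01⟩ := hB 0 1 Λ hΛ hΛ0
  obtain ⟨C20, p20, h20⟩ := hB 2 0 Λ hΛ hΛ0
  obtain ⟨C11, p11, h11⟩ := hB 1 1 Λ hΛ hΛ0
  obtain ⟨C02, p02, h02⟩ := hB 0 2 Λ hΛ hΛ0
  refine ⟨C10 + C01 + C20 + C11 + C02, by positivity, ?_⟩
  intro x l hlΛ
  have hl : 0 < l := hΛ0 hlΛ
  have h10 := h10 x l hlΛ
  have h01 := h01 x l hlΛ
  have h20 := h20 x l hlΛ
  have h11 := h11 x l hlΛ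
  have h02 := h02 x l hlΛ
  have hq : (fun y => iteratedDerivWithin 1 (fun l => Y y l) (Set.Ioi 0) l)
      = fun y => hQ n Y (y, l) := funext fun y => h_iter1 y l hl
  have e1 : (1 - ((1:ℕ):ℝ) - μ) = -μ := by push_cast; ring
  have e2 : (1 - ((2:ℕ):ℝ) - μ) = -1 - μ := by push_cast; ring
  have e0 : (1 - ((0:ℕ):ℝ) - μ) = 1 - μ := by push_cast; ring
  simp only [iteratedDerivWithin_zero] at h10 h20
  rw [hq] at h01 h11
  rw [norm_iteratedFDeriv_zero, e0] at h01
  rw [norm_iteratedFDeriv_zero, e0, h_iter2 x l hl] at h02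
  rw [norm_iteratedFDeriv_one, e1] at h10 h11
  rw [← norm_iteratedFDeriv_fderiv, norm_iteratedFDeriv_one, e2] at h20
  have hmono : ∀ (c s : ℝ), c ≤ C10 + C01 + C20 + C11 + C02 →
      c * (1 + ‖x‖) ^ s ≤ (C10 + C01 + C20 + C11 + C02) * (1 + ‖x‖) ^ s := by
    intro c s hc
    gcongr
  have hmem : Set.univ ×ˢ Set.Ioi (0:ℝ) ∈ 𝓝 (x, l) :=
    (isOpen_univ.prod isOpen_Ioi).mem_nhds ⟨trivial, hl⟩
  have hQd : DifferentiableAt ℝ (hQ n Y) (x, l) :=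
    ((h_Qsm hf).contDiffAt hmem).differentiableAt (by simp)
  refine ⟨?_, ?_, ?_, ?_, ?_, ?_⟩
  · rw [hP, hL, hLn]
    exact h10.trans (hmono _ _ (by linarith))
  · exact h01.trans (hmono _ _ (by linarith))
  · have hYx : ContDiff ℝ ∞ (fun y => Y y l) := by
      rw [contDiff_iff_contDiffAt]
      intro y
      have := (h_cd hf y l hl).comp y (contDiffAt_id.prodMk contDiffAt_const)
      exact this
    have h1 : DifferentiableAt ℝ (fderiv ℝ (fun y => Y y l)) x :=
      ((hYx.fderiv_right (m := ∞) (by simp)).differentiable (by simp)) x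
    refine ⟨L ∘L fderiv ℝ (fderiv ℝ (fun y => Y y l)) x, ?_, ?_⟩
    · have := L.hasFDerivAt.comp x h1.hasFDerivAt
      refine this.congr_of_eventuallyEq (Eventually.of_forall fun y => ?_)
      exact hL _ _
    · refine (ContinuousLinearMap.opNorm_le_bound _ (norm_nonneg _) fun v => ?_).trans
        (h20.trans (hmono _ _ (by linarith)))
      rw [ContinuousLinearMap.comp_apply, hLn]
      exact ContinuousLinearMap.le_opNorm _ _
  · have h1 := h_mixed hf x l hl
    refine ⟨L (fderiv ℝ (fun y => hQ n Y (y, l)) x), ?_, ?_⟩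
    · have := L.hasFDerivAt.comp_hasDerivAt l h1
      refine this.congr_of_eventuallyEq (Eventually.of_forall fun m => ?_)
      exact hL _ _
    · rw [hLn]
      exact h11.trans (hmono _ _ (by linarith))
  · refine ⟨fderiv ℝ (fun y => hQ n Y (y, l)) x, ?_, h11.trans (hmono _ _ (by linarith))⟩
    apply DifferentiableAt.hasFDerivAt
    exact (hQd.hasFDerivAt.comp x (hasFDerivAt_prodMk_left (𝕜 := ℝ) x l)).differentiableAt
  · refine ⟨deriv (fun m => hQ n Y (x, m)) l, ?_, h02.trans (hmono _ _ (by linarith))⟩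
    apply DifferentiableAt.hasDerivAt
    exact (hQd.hasFDerivAt.comp l (hasFDerivAt_prodMk_right (𝕜 := ℝ) x l)).differentiableAt

theorem h_rpow (m M s : ℝ) (hm : 0 < m) (hM : 0 < M) :
    ∃ C > 0, ∀ u v : ℝ, 0 < u → 0 < v → m * v ≤ u → u ≤ M * v → u ^ s ≤ C * v ^ s := by
  refine ⟨m ^ s + M ^ s, by positivity, ?_⟩
  intro u v hu hv h1 h2
  have hvs : 0 < v ^ s := by positivity
  have hms : 0 < m ^ s := by positivity
  have hMs : 0 < M ^ s := by positivity
  rcases le_total 0 s with h | h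
  · have := Real.rpow_le_rpow hu.le h2 h
    rw [Real.mul_rpow hM.le hv.le] at this
    nlinarith
  · have := Real.rpow_le_rpow_of_nonpos (by positivity) h1 h
    rw [Real.mul_rpow hm.le hv.le] at this
    nlinarith

theorem h_lip {n : ℕ} {H : Type*} [NormedAddCommGroup H] [NormedSpace ℝ H]
    (g : Euc n × ℝ → H) (c : Euc n × ℝ) (r ε : ℝ) (hε : 0 ≤ ε)
    (h1 : ∀ p ∈ closedBall c r, ∃ A : Euc n →L[ℝ] H,
      HasFDerivAt (fun y => g (y, p.2)) A p.1 ∧ ‖A‖ ≤ ε)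
    (h2 : ∀ p ∈ closedBall c r, ∃ v : H, HasDerivAt (fun m => g (p.1, m)) v p.2 ∧ ‖v‖ ≤ ε)
    (p : Euc n × ℝ) (hp : p ∈ closedBall c r) (p' : Euc n × ℝ) (hp' : p' ∈ closedBall c r) :
    ‖g p - g p'‖ ≤ 2 * ε * ‖p - p'‖ := by
  obtain ⟨x, l⟩ := p
  obtain ⟨x', l'⟩ := p'
  obtain ⟨c1, c2⟩ := c
  have hmem : ∀ y m, (y, m) ∈ closedBall ((c1, c2) : Euc n × ℝ) r ↔
      y ∈ closedBall c1 r ∧ m ∈ closedBall c2 r := by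
    intro y m
    rw [← closedBall_prod_same]; rfl
  rw [hmem] at hp hp'
  have a1 : ‖g (x, l) - g (x', l)‖ ≤ ε * ‖x - x'‖ := by
    have : ∀ y, ∃ A : Euc n →L[ℝ] H, y ∈ closedBall c1 r →
        HasFDerivAt (fun y => g (y, l)) A y ∧ ‖A‖ ≤ ε := by
      intro y
      by_cases hy : y ∈ closedBall c1 r
      · obtain ⟨A, hA⟩ := h1 (y, l) ((hmem _ _).2 ⟨hy, hp.2⟩)
        exact ⟨A, fun _ => hA⟩
      · exact ⟨0, fun h => absurd h hy⟩
    choose A hA using this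
    exact (convex_closedBall c1 r).norm_image_sub_le_of_norm_hasFDerivWithin_le
      (f := fun y => g (y, l)) (f' := A)
      (fun y hy => (hA y hy).1.hasFDerivWithinAt) (fun y hy => (hA y hy).2) hp'.1 hp.1
  have a2 : ‖g (x', l) - g (x', l')‖ ≤ ε * ‖l - l'‖ := by
    have : ∀ m, ∃ v : H, m ∈ closedBall c2 r →
        HasDerivAt (fun m => g (x', m)) v m ∧ ‖v‖ ≤ ε := by
      intro m
      by_cases hm : m ∈ closedBall c2 r
      · obtain ⟨A, hA⟩ := h2 (x', m) ((hmem _ _).2 ⟨hp'.1, hm⟩)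
        exact ⟨A, fun _ => hA⟩
      · exact ⟨0, fun h => absurd h hm⟩
    choose v hv using this
    exact (convex_closedBall c2 r).norm_image_sub_le_of_norm_hasDerivWithin_le
      (f := fun m => g (x', m)) (f' := v)
      (fun y hy => (hv y hy).1.hasDerivWithinAt) (fun y hy => (hv y hy).2) hp'.2 hp.2
  have b1 : ‖x - x'‖ ≤ ‖((x, l) : Euc n × ℝ) - (x', l')‖ :=
    norm_fst_le (((x, l) : Euc n × ℝ) - (x', l'))
  have b2 : ‖l - l'‖ ≤ ‖((x, l) : Euc n × ℝ) - (x', l')‖ :=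
    norm_snd_le (((x, l) : Euc n × ℝ) - (x', l'))
  calc ‖g (x, l) - g (x', l')‖ ≤ ‖g (x, l) - g (x', l)‖ + ‖g (x', l) - g (x', l')‖ :=
        norm_sub_le_norm_sub_add_norm_sub _ _ _
    _ ≤ _ := by nlinarith

/-- radius -/
def hr (n : ℕ) (ξ : Euc n) : ℝ := min (‖ξ‖ / 2) (‖ξ‖ ^ 2 / 2)

/-- centre -/
def hc (n : ℕ) (ξ : Euc n) : Euc n × ℝ := (ξ, ‖ξ‖ ^ 2)

theorem h_ball (n : ℕ) (ξ : Euc n) (p : Euc n × ℝ) (hp : p ∈ closedBall (hc n ξ) (hr n ξ)) :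
    ‖ξ‖ / 2 ≤ ‖p.1‖ ∧ ‖p.1‖ ≤ 3 / 2 * ‖ξ‖ ∧ ‖ξ‖ ^ 2 / 2 ≤ p.2 ∧ p.2 ≤ 2 * ‖ξ‖ ^ 2 := by
  have hn : ‖p - hc n ξ‖ ≤ hr n ξ := by simpa [dist_eq_norm] using hp
  have h1 : ‖p.1 - ξ‖ ≤ ‖ξ‖ / 2 := ((norm_fst_le (p - hc n ξ)).trans hn).trans (min_le_left _ _)
  have h2 : ‖p.2 - ‖ξ‖ ^ 2‖ ≤ ‖ξ‖ ^ 2 / 2 :=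
    ((norm_snd_le (p - hc n ξ)).trans hn).trans (min_le_right _ _)
  rw [Real.norm_eq_abs, abs_le] at h2
  have h3 : ‖p.1‖ - ‖ξ‖ ≤ ‖p.1 - ξ‖ := norm_sub_norm_le _ _
  have h4 : ‖ξ‖ - ‖p.1‖ ≤ ‖p.1 - ξ‖ := by rw [norm_sub_rev]; exact norm_sub_norm_le _ _
  refine ⟨by linarith, by linarith, by linarith, ?_⟩
  nlinarith [sq_nonneg ‖ξ‖]

/-- scaled gradient -/
def ha (n : ℕ) (Y : Euc n → ℝ → ℝ) (t : ℝ) (p : Euc n × ℝ) : Euc n := hP n Y ((2 * t) • p.1, p.2)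

/-- scaled energy derivative -/
def hb (n : ℕ) (Y : Euc n → ℝ → ℝ) (t : ℝ) (p : Euc n × ℝ) : ℝ :=
  t⁻¹ * hQ n Y ((2 * t) • p.1, p.2)

theorem h_scale {n : ℕ} {H : Type*} [NormedAddCommGroup H] [NormedSpace ℝ H]
    (g : Euc n → H) (k : ℝ) (hk : 0 ≤ k) (x : Euc n) (A : Euc n →L[ℝ] H)
    (h : HasFDerivAt g A (k • x)) :
    ∃ B : Euc n →L[ℝ] H, HasFDerivAt (fun y => g (k • y)) B x ∧ ‖B‖ ≤ k * ‖A‖ := by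
  refine ⟨k • A, ?_, by rw [norm_smul, Real.norm_of_nonneg hk]⟩
  have h0 : HasFDerivAt (fun y : Euc n => k • y) (k • ContinuousLinearMap.id ℝ (Euc n)) x :=
    (hasFDerivAt_id x).const_smul k
  have := h.comp x h0
  have e : A ∘L (k • ContinuousLinearMap.id ℝ (Euc n)) = k • A := by
    ext v
    simp
  rw [e] at this
  exact this

theorem h_est {n : ℕ} {μ : ℝ} {V : Euc n → ℝ} {Y : Euc n → ℝ → ℝ}
    (hY : IsEikonalPhase n μ V Y) (m M : ℝ) (hm : 0 < m) (hM : 0 < M) :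
    ∃ C > 0, ∀ ξ : Euc n, m ≤ ‖ξ‖ → ‖ξ‖ ≤ M → ∀ t : ℝ, 1 ≤ t →
      ∀ p ∈ closedBall (hc n ξ) (hr n ξ),
        ‖ha n Y t p‖ ≤ C * (1 + t) ^ (-μ) ∧ ‖hb n Y t p‖ ≤ C * (1 + t) ^ (-μ) ∧
        ∀ p' ∈ closedBall (hc n ξ) (hr n ξ),
          ‖ha n Y t p - ha n Y t p'‖ ≤ C * (1 + t) ^ (-μ) * ‖p - p'‖ ∧
          ‖hb n Y t p - hb n Y t p'‖ ≤ C * (1 + t) ^ (-μ) * ‖p - p'‖ := by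
  obtain ⟨C0, p0, hC0⟩ := h_bounds hY (Set.Icc (m ^ 2 / 2) (2 * M ^ 2)) isCompact_Icc
    (fun l hl => lt_of_lt_of_le (by positivity) hl.1)
  have hmin : 0 < min 1 m := lt_min one_pos hm
  obtain ⟨C1, p1, hC1⟩ := h_rpow (min 1 m) (1 + 3 * M) (-μ) hmin (by positivity)
  obtain ⟨C2, p2, hC2⟩ := h_rpow (min 1 m) (1 + 3 * M) (1 - μ) hmin (by positivity)
  obtain ⟨C3, p3, hC3⟩ := h_rpow (min 1 m) (1 + 3 * M) (-1 - μ) hmin (by positivity)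
  set K := 2 * (C0 * C1 + C0 * C2 + C0 * C3) with hK
  have q1 : 0 < C0 * C1 := by positivity
  have q2 : 0 < C0 * C2 := by positivity
  have q3 : 0 < C0 * C3 := by positivity
  refine ⟨2 * K, by positivity, ?_⟩
  intro ξ hξm hξM t ht
  have ht0 : 0 < t := by linarith
  set w := (1 + t) ^ (-μ) with hw
  have hw0 : 0 < w := by positivity
  have e2 : (1 + t) ^ (1 - μ) = (1 + t) * w := by
    rw [sub_eq_add_neg, Real.rpow_add (by positivity), Real.rpow_one]
  have e3 : (1 + t) ^ (-1 - μ) = (1 + t)⁻¹ * w := by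
    rw [sub_eq_add_neg, Real.rpow_add (by positivity), Real.rpow_neg_one]
  have i2 : t⁻¹ * (1 + t) ≤ 2 := by
    rw [inv_mul_le_iff₀ ht0]; linarith
  have i3 : t * (1 + t)⁻¹ ≤ 1 := by
    rw [mul_inv_le_iff₀ (by positivity)]; linarith
  -- pointwise bounds
  have key : ∀ p ∈ closedBall (hc n ξ) (hr n ξ),
      ‖ha n Y t p‖ ≤ K * w ∧ ‖hb n Y t p‖ ≤ K * w ∧
      (∃ A : Euc n →L[ℝ] Euc n, HasFDerivAt (fun y => ha n Y t (y, p.2)) A p.1 ∧ ‖A‖ ≤ K * w) ∧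
      (∃ v : Euc n, HasDerivAt (fun m => ha n Y t (p.1, m)) v p.2 ∧ ‖v‖ ≤ K * w) ∧
      (∃ A : Euc n →L[ℝ] ℝ, HasFDerivAt (fun y => hb n Y t (y, p.2)) A p.1 ∧ ‖A‖ ≤ K * w) ∧
      (∃ v : ℝ, HasDerivAt (fun m => hb n Y t (p.1, m)) v p.2 ∧ ‖v‖ ≤ K * w) := by
    intro p hp
    obtain ⟨b1, b2, b3, b4⟩ := h_ball n ξ p hp
    have hl : p.2 ∈ Set.Icc (m ^ 2 / 2) (2 * M ^ 2) := by
      constructor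
      · nlinarith
      · nlinarith [norm_nonneg ξ]
    have hx : ‖(2 * t) • p.1‖ = 2 * t * ‖p.1‖ := by
      rw [norm_smul, Real.norm_of_nonneg (by positivity)]
    obtain ⟨g1, g2, ⟨A3, d3, g3⟩, ⟨v4, d4, g4⟩, ⟨A5, d5, g5⟩, ⟨v6, d6, g6⟩⟩ :=
      hC0 ((2 * t) • p.1) p.2 hl
    set x := (2 * t) • p.1 with hxdef
    have hx1 : min 1 m * (1 + t) ≤ 1 + ‖x‖ := by
      rw [hx]
      have j1 : min 1 m ≤ 1 := min_le_left _ _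
      have j2 : min 1 m ≤ m := min_le_right _ _
      have j3 : min 1 m * t ≤ m * t := by gcongr
      nlinarith
    have hx2 : 1 + ‖x‖ ≤ (1 + 3 * M) * (1 + t) := by
      rw [hx]
      have : t * ‖p.1‖ ≤ t * (3 / 2 * M) := by gcongr; linarith
      nlinarith
    have hx0 : 0 < 1 + ‖x‖ := by positivity
    have ht1 : 0 < 1 + t := by positivity
    have f1 := hC1 _ _ hx0 ht1 hx1 hx2
    have f2 := hC2 _ _ hx0 ht1 hx1 hx2
    have f3 := hC3 _ _ hx0 ht1 hx1 hx2
    rw [e2] at f2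
    rw [e3] at f3
    have r1 : C0 * (1 + ‖x‖) ^ (-μ) ≤ C0 * C1 * w := by
      rw [mul_assoc]; gcongr
    have r2 : t⁻¹ * (C0 * (1 + ‖x‖) ^ (1 - μ)) ≤ 2 * (C0 * C2) * w := by
      calc t⁻¹ * (C0 * (1 + ‖x‖) ^ (1 - μ)) ≤ t⁻¹ * (C0 * (C2 * ((1 + t) * w))) := by gcongr
        _ = (t⁻¹ * (1 + t)) * ((C0 * C2) * w) := by ring
        _ ≤ 2 * ((C0 * C2) * w) := by gcongr
        _ = _ := by ring
    have r3 : 2 * t * (C0 * (1 + ‖x‖) ^ (-1 - μ)) ≤ 2 * (C0 * C3) * w := by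
      calc 2 * t * (C0 * (1 + ‖x‖) ^ (-1 - μ)) ≤ 2 * t * (C0 * (C3 * ((1 + t)⁻¹ * w))) := by gcongr
        _ = (t * (1 + t)⁻¹) * (2 * (C0 * C3) * w) := by ring
        _ ≤ 1 * (2 * (C0 * C3) * w) := by gcongr
        _ = _ := by ring
    have s1 : 0 < C0 * C1 * w := by positivity
    have s2 : 0 < C0 * C2 * w := by positivity
    have s3 : 0 < C0 * C3 * w := by positivity
    have hKw : K * w = 2 * (C0 * C1 * w) + 2 * (C0 * C2) * w + 2 * (C0 * C3) * w := by
      rw [hK]; ring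
    have ht' : ‖t⁻¹‖ = t⁻¹ := Real.norm_of_nonneg (by positivity)
    refine ⟨?_, ?_, ?_, ?_, ?_, ?_⟩
    · rw [ha]; linarith
    · rw [hb, norm_mul, ht']
      have : t⁻¹ * ‖hQ n Y (x, p.2)‖ ≤ t⁻¹ * (C0 * (1 + ‖x‖) ^ (1 - μ)) := by gcongr
      linarith
    · obtain ⟨B, hB, hBn⟩ := h_scale (fun y => hP n Y (y, p.2)) (2 * t) (by positivity) p.1 A3 d3
      refine ⟨B, hB, ?_⟩
      have : 2 * t * ‖A3‖ ≤ 2 * t * (C0 * (1 + ‖x‖) ^ (-1 - μ)) := by gcongr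
      linarith
    · exact ⟨v4, d4, by linarith⟩
    · obtain ⟨B, hB, hBn⟩ := h_scale (fun y => hQ n Y (y, p.2)) (2 * t) (by positivity) p.1 A5 d5
      refine ⟨t⁻¹ • B, hB.const_smul t⁻¹, ?_⟩
      rw [norm_smul, ht']
      have : t⁻¹ * ‖B‖ ≤ t⁻¹ * (2 * t * (C0 * (1 + ‖x‖) ^ (-μ))) := by
        gcongr
        exact hBn.trans (by gcongr)
      have e : t⁻¹ * (2 * t * (C0 * (1 + ‖x‖) ^ (-μ))) = 2 * (C0 * (1 + ‖x‖) ^ (-μ)) := by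
        field_simp
      linarith
    · refine ⟨t⁻¹ * v6, d6.const_mul t⁻¹, ?_⟩
      rw [norm_mul, ht']
      have : t⁻¹ * ‖v6‖ ≤ t⁻¹ * (C0 * (1 + ‖x‖) ^ (1 - μ)) := by gcongr
      linarith
  have hKw0 : 0 ≤ K * w := by positivity
  intro p hp
  obtain ⟨k1, k2, -⟩ := key p hp
  refine ⟨by nlinarith, by nlinarith, ?_⟩
  intro p' hp'
  constructor
  · have := h_lip (ha n Y t) _ _ (K * w) hKw0 (fun p hp => (key p hp).2.2.1)
      (fun p hp => (key p hp).2.2.2.1) p hp p' hp'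
    rwa [← mul_assoc] at this
  · have := h_lip (hb n Y t) _ _ (K * w) hKw0 (fun p hp => (key p hp).2.2.2.2.1)
      (fun p hp => (key p hp).2.2.2.2.2) p hp p' hp'
    rwa [← mul_assoc] at this

/-- the fixed point map -/
def hΦ (n : ℕ) (Y : Euc n → ℝ → ℝ) (u : (Euc n × ℝ) × (Euc n × ℝ)) : Euc n × ℝ :=
  ((1 + hb n Y u.1.2 u.2) • (u.1.1 + ha n Y u.1.2 u.2), ‖u.1.1 + ha n Y u.1.2 u.2‖ ^ 2)

theorem h_sq_sub {n : ℕ} (x y : Euc n) : ‖‖x‖ ^ 2 - ‖y‖ ^ 2‖ ≤ ‖x - y‖ * (‖x‖ + ‖y‖) := by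
  have : ‖x‖ ^ 2 - ‖y‖ ^ 2 = (‖x‖ - ‖y‖) * (‖x‖ + ‖y‖) := by ring
  rw [this, norm_mul, Real.norm_of_nonneg (by positivity : 0 ≤ ‖x‖ + ‖y‖)]
  gcongr
  exact abs_norm_sub_norm_le x y

theorem h_main {n : ℕ} {μ : ℝ} (hμ0 : 0 < μ) {V : Euc n → ℝ} {Y : Euc n → ℝ → ℝ}
    (hY : IsEikonalPhase n μ V Y) (A : Set (Euc n)) (hA : IsCompact A)
    (hA0 : A ⊆ {ξ : Euc n | ξ ≠ 0}) :
    ∃ T > 0, ∃ C > 0, ∀ ξ ∈ A, ∀ t, T < t →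
      ∀ p ∈ closedBall (hc n ξ) (hr n ξ),
        0 < 1 + hb n Y t p ∧ hΦ n Y ((ξ, t), p) ∈ ball (hc n ξ) (hr n ξ) ∧
        ‖hΦ n Y ((ξ, t), p) - hc n ξ‖ ≤ C * (1 + t) ^ (-μ) ∧
        ∀ p' ∈ closedBall (hc n ξ) (hr n ξ),
          ‖hΦ n Y ((ξ, t), p) - hΦ n Y ((ξ, t), p')‖ ≤ 1 / 2 * ‖p - p'‖ := by
  obtain ⟨m, hm, hmA⟩ := hA.exists_forall_le' continuous_norm.continuousOn (a := 0)
    (fun ξ hξ => norm_pos_iff.2 (hA0 hξ))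
  obtain ⟨M, hM, hMA⟩ := hA.isBounded.exists_pos_norm_le
  obtain ⟨C, hC, hest⟩ := h_est hY m M hm hM
  set ρ := min (m / 2) (m ^ 2 / 2) with hρ
  have hρ0 : 0 < ρ := lt_min (by positivity) (by positivity)
  have hlim : Tendsto (fun t : ℝ => (2 * M + 3) * (C * (1 + t) ^ (-μ))) atTop (𝓝 0) := by
    have h1 : Tendsto (fun t : ℝ => (1 + t) ^ (-μ)) atTop (𝓝 0) :=
      (tendsto_rpow_neg_atTop hμ0).comp (tendsto_atTop_add_const_left _ 1 tendsto_id)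
    simpa using (h1.const_mul C).const_mul (2 * M + 3)
  have hev := (hlim.eventually (gt_mem_nhds (lt_min hρ0 (by norm_num : (0:ℝ) < 1 / 2))))
  obtain ⟨T0, hT0⟩ := eventually_atTop.1 hev
  refine ⟨max T0 1, by positivity, (2 * M + 3) * C, by positivity, ?_⟩
  intro ξ hξ t ht p hp
  have ht1 : 1 ≤ t := ((le_max_right _ _).trans_lt ht).le
  have hsmall := hT0 t ((le_max_left _ _).trans_lt ht).le
  have hξm := hmA ξ hξ
  have hξM := hMA ξ hξ
  obtain ⟨e1, e2, e3⟩ := hest ξ hξm hξM t ht1 p hp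
  have hρr : ρ ≤ hr n ξ := by
    refine min_le_min (by linarith) ?_
    gcongr
  set δ := C * (1 + t) ^ (-μ) with hδ
  have hδ0 : 0 < δ := by positivity
  have hs1 : (2 * M + 3) * δ < ρ := hsmall.trans_le (min_le_left _ _)
  have hs2 : (2 * M + 3) * δ < 1 / 2 := hsmall.trans_le (min_le_right _ _)
  have hδ1 : δ < 1 := by nlinarith
  have heq : (2 * M + 3) * C * (1 + t) ^ (-μ) = (2 * M + 3) * δ := by rw [hδ]; ring
  have hMδ : 0 < M * δ := by positivity
  have hδδ : δ * δ ≤ δ := by nlinarith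
  have hηn : ‖ξ + ha n Y t p‖ ≤ M + 1 := (norm_add_le _ _).trans (by linarith)
  have hdev : ‖hΦ n Y ((ξ, t), p) - hc n ξ‖ ≤ (2 * M + 3) * δ := by
    refine norm_prod_le_iff.2 ⟨?_, ?_⟩
    · have : (hΦ n Y ((ξ, t), p) - hc n ξ).1
          = ha n Y t p + hb n Y t p • (ξ + ha n Y t p) := by
        simp only [hΦ, hc, Prod.fst_sub]
        module
      rw [this]
      calc _ ≤ ‖ha n Y t p‖ + ‖hb n Y t p‖ * ‖ξ + ha n Y t p‖ := by
            rw [← norm_smul]; exact norm_add_le _ _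
        _ ≤ δ + δ * (M + 1) := by gcongr
        _ ≤ _ := by nlinarith
    · have : (hΦ n Y ((ξ, t), p) - hc n ξ).2 = ‖ξ + ha n Y t p‖ ^ 2 - ‖ξ‖ ^ 2 := rfl
      rw [this]
      calc _ ≤ ‖ξ + ha n Y t p - ξ‖ * (‖ξ + ha n Y t p‖ + ‖ξ‖) := h_sq_sub _ _
        _ ≤ δ * ((M + 1) + M) := by
            rw [add_sub_cancel_left]; gcongr
        _ ≤ _ := by nlinarith
  refine ⟨?_, ?_, by rw [heq]; exact hdev, ?_⟩
  · rw [Real.norm_eq_abs, abs_le] at e2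
    linarith
  · rw [mem_ball, dist_eq_norm]
    linarith
  · intro p' hp'
    obtain ⟨e4, e5⟩ := e3 p' hp'
    obtain ⟨e1', e2', -⟩ := hest ξ hξm hξM t ht1 p' hp'
    have hηn' : ‖ξ + ha n Y t p'‖ ≤ M + 1 := (norm_add_le _ _).trans (by linarith)
    have hd0 : 0 ≤ ‖p - p'‖ := norm_nonneg _
    have hfin : (2 * M + 3) * δ * ‖p - p'‖ ≤ 1 / 2 * ‖p - p'‖ := by gcongr
    refine le_trans (norm_prod_le_iff.2 ⟨?_, ?_⟩) hfin
    · have : (hΦ n Y ((ξ, t), p) - hΦ n Y ((ξ, t), p')).1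
          = (1 + hb n Y t p) • (ha n Y t p - ha n Y t p')
            + (hb n Y t p - hb n Y t p') • (ξ + ha n Y t p') := by
        simp only [hΦ, Prod.fst_sub]
        module
      rw [this]
      have hb1 : ‖1 + hb n Y t p‖ ≤ 2 := (norm_add_le _ _).trans (by rw [norm_one]; linarith)
      calc _ ≤ ‖1 + hb n Y t p‖ * ‖ha n Y t p - ha n Y t p'‖
            + ‖hb n Y t p - hb n Y t p'‖ * ‖ξ + ha n Y t p'‖ := by
            rw [← norm_smul, ← norm_smul]; exact norm_add_le _ _
        _ ≤ 2 * (δ * ‖p - p'‖) + δ * ‖p - p'‖ * (M + 1) := by gcongr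
        _ ≤ _ := by nlinarith [mul_nonneg hMδ.le hd0]
    · have : (hΦ n Y ((ξ, t), p) - hΦ n Y ((ξ, t), p')).2
          = ‖ξ + ha n Y t p‖ ^ 2 - ‖ξ + ha n Y t p'‖ ^ 2 := rfl
      rw [this]
      calc _ ≤ ‖ξ + ha n Y t p - (ξ + ha n Y t p')‖ * (‖ξ + ha n Y t p‖ + ‖ξ + ha n Y t p'‖) :=
            h_sq_sub _ _
        _ ≤ δ * ‖p - p'‖ * ((M + 1) + (M + 1)) := by
            rw [add_sub_add_left_eq_sub]; gcongr
        _ ≤ _ := by nlinarith [mul_nonneg hMδ.le hd0, mul_nonneg hδ0.le hd0]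

theorem h_Φsm {n : ℕ} {Y : Euc n → ℝ → ℝ}
    (hf : ContDiffOn ℝ ∞ (fun p : Euc n × ℝ => Y p.1 p.2) (Set.univ ×ˢ Set.Ioi 0))
    (q p : Euc n × ℝ) (ht : 0 < q.2) (hl : 0 < p.2) : ContDiffAt ℝ ∞ (hΦ n Y) (q, p) := by
  have hin : ContDiffAt ℝ ∞ (fun u : (Euc n × ℝ) × (Euc n × ℝ) => ((2 * u.1.2) • u.2.1, u.2.2))
      (q, p) := by fun_prop
  have hmem : Set.univ ×ˢ Set.Ioi (0:ℝ) ∈ 𝓝 ((2 * q.2) • p.1, p.2) :=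
    (isOpen_univ.prod isOpen_Ioi).mem_nhds ⟨trivial, hl⟩
  have hPs : ContDiffAt ℝ ∞ (fun u : (Euc n × ℝ) × (Euc n × ℝ) => ha n Y u.1.2 u.2) (q, p) :=
    ContDiffAt.comp (g := hP n Y) (q, p) ((h_Psm hf).contDiffAt hmem) hin
  have hQs : ContDiffAt ℝ ∞ (fun u : (Euc n × ℝ) × (Euc n × ℝ) =>
      hQ n Y ((2 * u.1.2) • u.2.1, u.2.2)) (q, p) :=
    ContDiffAt.comp (g := hQ n Y) (q, p) ((h_Qsm hf).contDiffAt hmem) hin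
  have hti : ContDiffAt ℝ ∞ (fun u : (Euc n × ℝ) × (Euc n × ℝ) => (u.1.2)⁻¹) (q, p) :=
    ContDiffAt.inv (by fun_prop) ht.ne'
  have hbs : ContDiffAt ℝ ∞ (fun u : (Euc n × ℝ) × (Euc n × ℝ) => hb n Y u.1.2 u.2) (q, p) :=
    hti.mul hQs
  have hη : ContDiffAt ℝ ∞ (fun u : (Euc n × ℝ) × (Euc n × ℝ) => u.1.1 + ha n Y u.1.2 u.2) (q, p) :=
    ContDiffAt.add (by fun_prop) hPs
  exact ((contDiffAt_const.add hbs).smul hη).prodMk (hη.norm_sq ℝ)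

theorem h_eqs {n : ℕ} {Y : Euc n → ℝ → ℝ}
    (hf : ContDiffOn ℝ ∞ (fun p : Euc n × ℝ => Y p.1 p.2) (Set.univ ×ˢ Set.Ioi 0))
    (ξ : Euc n) (t : ℝ) (p : Euc n × ℝ) (ht : 0 < t) (hl : 0 < p.2) (hb0 : 0 < 1 + hb n Y t p)
    (hfix : hΦ n Y ((ξ, t), p) = p) :
    ξ = gradient (fun y => Kfun n Y p.2 y) ((2 * t) • p.1) ∧
      t = deriv (fun l => Kfun n Y l ((2 * t) • p.1)) p.2 := by
  set η := ξ + ha n Y t p with hη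
  have h1 : (1 + hb n Y t p) • η = p.1 := congrArg Prod.fst hfix
  have h2 : ‖η‖ ^ 2 = p.2 := congrArg Prod.snd hfix
  have hη0 : 0 < ‖η‖ := by
    rcases (norm_nonneg η).eq_or_lt with h | h
    · rw [← h] at h2; norm_num at h2; linarith
    · exact h
  have hsq : √p.2 = ‖η‖ := by rw [← h2, Real.sqrt_sq hη0.le]
  set κ := 2 * t * (1 + hb n Y t p) with hκ
  have hκ0 : 0 < κ := by positivity
  set x := (2 * t) • p.1 with hx
  have hxη : x = κ • η := by rw [hx, ← h1, smul_smul]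
  have hxn : ‖x‖ = κ * ‖η‖ := by rw [hxη, norm_smul, Real.norm_of_nonneg hκ0.le]
  have hx0 : 0 < ‖x‖ := by rw [hxn]; positivity
  constructor
  · have hnorm : HasFDerivAt (fun y : Euc n => ‖y‖) (‖x‖⁻¹ • innerSL ℝ x) x := by
      have h3 := (hasStrictFDerivAt_norm_sq x).hasFDerivAt.sqrt (by positivity)
      have h4 : (fun y : Euc n => √(‖y‖ ^ 2)) = fun y => ‖y‖ :=
        funext fun y => Real.sqrt_sq (norm_nonneg y)
      rw [h4, Real.sqrt_sq (norm_nonneg x)] at h3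
      refine h3.congr_fderiv ?_
      ext v
      simp
      field_simp
    have hYd : HasGradientAt (fun y => Y y p.2) (ha n Y t p) x :=
      (h_fx hf x p.2 hl).differentiableAt.hasGradientAt
    have hK : HasGradientAt (fun y => Kfun n Y p.2 y) ξ x := by
      rw [hasGradientAt_iff_hasFDerivAt] at hYd ⊢
      refine ((hnorm.const_mul (√p.2)).sub hYd).congr_fderiv ?_
      ext v
      have hξ : ξ = η - ha n Y t p := by rw [hη]; abel
      have hin : ⟪x, v⟫ = κ * ⟪η, v⟫ := by rw [hxη, real_inner_smul_left]
      have hin2 : ⟪ξ, v⟫ = ⟪η, v⟫ - ⟪ha n Y t p, v⟫ := by rw [hξ, inner_sub_left]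
      simp only [ContinuousLinearMap.sub_apply, ContinuousLinearMap.smul_apply,
        InnerProductSpace.toDual_apply_apply, innerSL_apply_apply, smul_eq_mul]
      rw [hin, hin2, hsq, hxn]
      field_simp
    exact hK.gradient.symm
  · have hd : HasDerivAt (fun l => Kfun n Y l x) (1 / (2 * √p.2) * ‖x‖ - hQ n Y (x, p.2)) p.2 := by
      rw [h_Qeq hf x p.2 hl]
      exact ((Real.hasDerivAt_sqrt hl.ne').mul_const ‖x‖).sub (h_fl hf x p.2 hl)
    rw [hd.deriv, hsq, hxn, hκ]
    have : hb n Y t p = t⁻¹ * hQ n Y (x, p.2) := rfl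
    rw [this]
    field_simp
    ring

theorem h_plus {n : ℕ} {μ : ℝ} (hμ0 : 0 < μ) {V : Euc n → ℝ} {Y : Euc n → ℝ → ℝ}
    (hY : IsEikonalPhase n μ V Y) :
    ∃ (xp : Euc n → ℝ → Euc n) (lamp : Euc n → ℝ → ℝ),
      ContDiffOn ℝ ∞ (fun p : Euc n × ℝ => xp p.1 p.2) ({ξ : Euc n | ξ ≠ 0} ×ˢ Set.Ioi 0) ∧
      ContDiffOn ℝ ∞ (fun p : Euc n × ℝ => lamp p.1 p.2) ({ξ : Euc n | ξ ≠ 0} ×ˢ Set.Ioi 0) ∧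
      (∀ ξ : Euc n, ξ ≠ 0 → ∀ t : ℝ, 0 < t → 0 < lamp ξ t) ∧
      ∀ A : Set (Euc n), IsCompact A → A ⊆ {ξ : Euc n | ξ ≠ 0} →
        ∃ T > 0, ∃ C > 0, ∀ ξ ∈ A,
          (∀ t : ℝ, T < t →
            ξ = gradient (fun y => Kfun n Y (lamp ξ t) y) (xp ξ t) ∧
            t = deriv (fun l => Kfun n Y l (xp ξ t)) (lamp ξ t) ∧
            ‖xp ξ t - (2 * t) • ξ‖ ≤ C * (1 + |t|) ^ (1 - μ) ∧
            |lamp ξ t - ‖ξ‖ ^ 2| ≤ C * (1 + |t|) ^ (-μ)) := by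
  have hf := hY.1
  obtain ⟨τ, hτ, hτG⟩ := h_tau n (fun ξ t => 0 < t ∧ ∀ p ∈ closedBall (hc n ξ) (hr n ξ),
      (0 < 1 + hb n Y t p ∧ hΦ n Y ((ξ, t), p) ∈ ball (hc n ξ) (hr n ξ) ∧
        ∀ p' ∈ closedBall (hc n ξ) (hr n ξ),
          ‖hΦ n Y ((ξ, t), p) - hΦ n Y ((ξ, t), p')‖ ≤ 1 / 2 * ‖p - p'‖)) (by
    intro A hA hA0
    obtain ⟨T, hT, C, hC, h⟩ := h_main hμ0 hY A hA hA0
    refine ⟨T, hT, fun ξ hξ t ht => ⟨hT.trans ht, fun p hp => ?_⟩⟩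
    obtain ⟨a, b, -, d⟩ := h ξ hξ t ht p hp
    exact ⟨a, b, d⟩)
  obtain ⟨χ, hχ, hχb, hχ0, hχ1⟩ := h_chi n τ hτ
  have hDo : IsOpen ({ξ : Euc n | ξ ≠ 0} ×ˢ Set.Ioi (0:ℝ)) := isOpen_ne.prod isOpen_Ioi
  have hτ' : ContinuousOn (fun p : Euc n × ℝ => τ p.1 - p.2)
      ({ξ : Euc n | ξ ≠ 0} ×ˢ Set.Ioi (0:ℝ)) :=
    (hτ.comp continuousOn_fst (fun p hp => hp.1)).sub continuousOn_snd
  have hW : IsOpen {p : Euc n × ℝ | p.1 ≠ 0 ∧ 0 < p.2 ∧ τ p.1 < p.2} := by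
    have := hτ'.isOpen_inter_preimage hDo (isOpen_Iio (a := 0))
    convert this using 1
    ext p
    simp [and_assoc]
  have hpos : ∀ ξ : Euc n, ξ ≠ 0 → ∀ p ∈ closedBall (hc n ξ) (hr n ξ), 0 < p.2 := by
    intro ξ hξ p hp
    have := (h_ball n ξ p hp).2.2.1
    have h3 : 0 < ‖ξ‖ := norm_pos_iff.2 hξ
    have : 0 < ‖ξ‖ ^ 2 / 2 := by positivity
    linarith
  obtain ⟨s, hs, hsp⟩ := h_param (hΦ n Y) {p : Euc n × ℝ | p.1 ≠ 0 ∧ 0 < p.2 ∧ τ p.1 < p.2} hW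
    (fun q => hc n q.1) (fun q => hr n q.1)
    (by unfold hc; fun_prop) (by unfold hr; fun_prop)
    (by
      intro q hq
      have h3 : 0 < ‖q.1‖ := norm_pos_iff.2 hq.1
      exact lt_min (by positivity) (by positivity))
    (by
      intro q hq p hp
      exact h_Φsm hf q p hq.2.1 (hpos q.1 hq.1 p (ball_subset_closedBall hp)))
    (by
      intro q hq p hp
      exact (((hτG q.1 hq.1).2 q.2 hq.2.2).2 p hp).2.1)
    (by
      intro q hq p hp p' hp'
      exact (((hτG q.1 hq.1).2 q.2 hq.2.2).2 p hp).2.2 p' hp')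
  have h2t : ContDiff ℝ ∞ (fun p : Euc n × ℝ => 2 * p.2) := by fun_prop
  refine ⟨fun ξ t => χ (ξ, t) • ((2 * t) • (s (ξ, t)).1) + (1 - χ (ξ, t)) • ((2 * t) • ξ),
    fun ξ t => χ (ξ, t) • (s (ξ, t)).2 + (1 - χ (ξ, t)) • (‖ξ‖ ^ 2), ?_, ?_, ?_, ?_⟩
  · exact h_glue n τ hτ χ hχ hχ0 (fun p => (2 * p.2) • (s p).1) (fun p => (2 * p.2) • p.1)
      (h2t.contDiffOn.smul hs.fst) (h2t.smul contDiff_fst).contDiffOn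
  · exact h_glue n τ hτ χ hχ hχ0 (fun p => (s p).2) (fun p => ‖p.1‖ ^ 2)
      hs.snd (contDiff_fst.norm_sq ℝ).contDiffOn
  · intro ξ hξ t ht
    have h3 : 0 < ‖ξ‖ := norm_pos_iff.2 hξ
    by_cases h : τ ξ < t
    · have hs2 := hpos ξ hξ _ (ball_subset_closedBall (hsp (ξ, t) ⟨hξ, ht, h⟩).1)
      obtain ⟨c0, c1⟩ := hχb (ξ, t)
      have h4 : 0 < ‖ξ‖ ^ 2 := by positivity
      simp only [smul_eq_mul]
      rcases c0.eq_or_lt with h5 | h5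
      · rw [← h5]; simpa using h4
      · have := mul_pos h5 hs2
        have := mul_nonneg (sub_nonneg.2 c1) h4.le
        linarith
    · simp only [hχ0 (ξ, t) ⟨hξ, ht⟩ (by simp only; linarith)]
      simpa using pow_pos h3 2
  · intro A hA hA0
    obtain ⟨T, hT, C, hC, h⟩ := h_main hμ0 hY A hA hA0
    obtain ⟨B, hB⟩ := hA.bddAbove_image (hτ.mono hA0)
    refine ⟨max T (B + 2), lt_max_of_lt_left hT, 2 * C, by positivity, ?_⟩
    intro ξ hξ t ht
    have hξ0 : ξ ≠ 0 := hA0 hξ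
    have htT : T < t := (le_max_left _ _).trans_lt ht
    have ht0 : 0 < t := hT.trans htT
    have htB : τ ξ + 2 < t := by
      have h1 : τ ξ ≤ B := hB ⟨ξ, hξ, rfl⟩
      have h2 : B + 2 < t := (le_max_right _ _).trans_lt ht
      linarith
    have hχt : χ (ξ, t) = 1 := hχ1 (ξ, t) ⟨hξ0, ht0⟩ htB.le
    obtain ⟨hsb, hsf⟩ := hsp (ξ, t) ⟨hξ0, ht0, by simp only; linarith⟩
    have hsb := ball_subset_closedBall hsb
    obtain ⟨k1, -, k3, -⟩ := h ξ hξ t htT _ hsb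
    obtain ⟨e1, e2⟩ := h_eqs hf ξ t _ ht0 (hpos ξ hξ0 _ hsb) k1 hsf
    rw [hsf] at k3
    have k4 : ‖(s (ξ, t)).1 - ξ‖ ≤ C * (1 + t) ^ (-μ) :=
      (norm_fst_le (s (ξ, t) - hc n ξ)).trans k3
    have k5 : |(s (ξ, t)).2 - ‖ξ‖ ^ 2| ≤ C * (1 + t) ^ (-μ) :=
      (norm_snd_le (s (ξ, t) - hc n ξ)).trans k3
    simp only [hχt, one_smul, sub_self, zero_smul, add_zero, abs_of_pos ht0]
    have hp0 : 0 < (1 + t) ^ (-μ) := by positivity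
    refine ⟨e1, e2, ?_, ?_⟩
    · rw [← smul_sub, norm_smul, Real.norm_of_nonneg (by positivity)]
      have : (1 + t) ^ (1 - μ) = (1 + t) * (1 + t) ^ (-μ) := by
        rw [sub_eq_add_neg, Real.rpow_add (by positivity), Real.rpow_one]
      rw [this]
      calc 2 * t * ‖(s (ξ, t)).1 - ξ‖ ≤ 2 * (1 + t) * (C * (1 + t) ^ (-μ)) := by
            gcongr
            linarith
        _ = _ := by ring
    · refine k5.trans ?_
      gcongr
      linarith

end helpers

/-- existence of the Legendre data `x_±(ξ,t), λ_±(ξ,t)` for the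
phase `K(x,λ) = √λ|x| − Y(x,λ)`: smooth on `(ℝ^n∖{0}) × ℝ_±`, with
`ξ = ±∇_x K(x_±,λ_±)`, `t = ±∂_λ K(x_±,λ_±)`, `|x_± − 2ξt| ≤ C(1+|t|)^{1-μ}`
and `|λ_± − |ξ|²| ≤ C(1+|t|)^{-μ}` uniformly on compact sets of `ξ ≠ 0`. -/
theorem stmt4 (n : ℕ) (μ : ℝ) (hμ0 : 0 < μ) (hμ1 : μ ≤ 1)
    (V : Euc n → ℝ) (hV : IsLongRangePotential n μ V)
    (Y : Euc n → ℝ → ℝ) (hY : IsEikonalPhase n μ V Y) :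
    ∃ (xp : Euc n → ℝ → Euc n) (lamp : Euc n → ℝ → ℝ)
      (xm : Euc n → ℝ → Euc n) (lamm : Euc n → ℝ → ℝ),
      ContDiffOn ℝ (⊤ : ℕ∞) (fun p : Euc n × ℝ => xp p.1 p.2)
        ({ξ : Euc n | ξ ≠ 0} ×ˢ Set.Ioi 0) ∧
      ContDiffOn ℝ (⊤ : ℕ∞) (fun p : Euc n × ℝ => lamp p.1 p.2)
        ({ξ : Euc n | ξ ≠ 0} ×ˢ Set.Ioi 0) ∧
      ContDiffOn ℝ (⊤ : ℕ∞) (fun p : Euc n × ℝ => xm p.1 p.2)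
        ({ξ : Euc n | ξ ≠ 0} ×ˢ Set.Iio 0) ∧
      ContDiffOn ℝ (⊤ : ℕ∞) (fun p : Euc n × ℝ => lamm p.1 p.2)
        ({ξ : Euc n | ξ ≠ 0} ×ˢ Set.Iio 0) ∧
      (∀ ξ : Euc n, ξ ≠ 0 → ∀ t : ℝ, 0 < t → 0 < lamp ξ t) ∧
      (∀ ξ : Euc n, ξ ≠ 0 → ∀ t : ℝ, t < 0 → 0 < lamm ξ t) ∧
      ∀ A : Set (Euc n), IsCompact A → A ⊆ {ξ : Euc n | ξ ≠ 0} →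
        ∃ T > 0, ∃ C > 0, ∀ ξ ∈ A,
          (∀ t : ℝ, T < t →
            ξ = gradient (fun y => Kfun n Y (lamp ξ t) y) (xp ξ t) ∧
            t = deriv (fun l => Kfun n Y l (xp ξ t)) (lamp ξ t) ∧
            ‖xp ξ t - (2 * t) • ξ‖ ≤ C * (1 + |t|) ^ (1 - μ) ∧
            |lamp ξ t - ‖ξ‖ ^ 2| ≤ C * (1 + |t|) ^ (-μ)) ∧
          (∀ t : ℝ, t < -T →
            ξ = -gradient (fun y => Kfun n Y (lamm ξ t) y) (xm ξ t) ∧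
            t = -deriv (fun l => Kfun n Y l (xm ξ t)) (lamm ξ t) ∧
            ‖xm ξ t - (2 * t) • ξ‖ ≤ C * (1 + |t|) ^ (1 - μ) ∧
            |lamm ξ t - ‖ξ‖ ^ 2| ≤ C * (1 + |t|) ^ (-μ)) := by
  obtain ⟨xp, lamp, h1, h2, h3, h4⟩ := h_plus hμ0 hY
  have hneg : ContDiffOn ℝ (⊤ : ℕ∞) (fun p : Euc n × ℝ => ((-p.1, -p.2) : Euc n × ℝ))
      ({ξ : Euc n | ξ ≠ 0} ×ˢ Set.Iio 0) := by fun_prop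
  have hmaps : Set.MapsTo (fun p : Euc n × ℝ => ((-p.1, -p.2) : Euc n × ℝ))
      ({ξ : Euc n | ξ ≠ 0} ×ˢ Set.Iio 0) ({ξ : Euc n | ξ ≠ 0} ×ˢ Set.Ioi 0) := by
    rintro ⟨ξ, t⟩ ⟨hξ, ht⟩
    exact ⟨neg_ne_zero.2 hξ, Set.mem_Ioi.2 (neg_pos.2 (Set.mem_Iio.1 ht))⟩
  refine ⟨xp, lamp, fun ξ t => xp (-ξ) (-t), fun ξ t => lamp (-ξ) (-t), h1, h2,
    h1.comp hneg hmaps, h2.comp hneg hmaps, h3,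
    fun ξ hξ t ht => h3 (-ξ) (neg_ne_zero.2 hξ) (-t) (neg_pos.2 ht), ?_⟩
  intro A hA hA0
  obtain ⟨T, hT, C, hC, h⟩ := h4 (A ∪ (fun ξ => -ξ) '' A)
    (hA.union (hA.image continuous_neg)) (by
      rintro ξ (hξ | ⟨ξ', hξ', rfl⟩)
      · exact hA0 hξ
      · exact neg_ne_zero.2 (hA0 hξ'))
  refine ⟨T, hT, C, hC, fun ξ hξ => ⟨h ξ (Or.inl hξ), fun t ht => ?_⟩⟩
  obtain ⟨a, b, c, d⟩ := h (-ξ) (Or.inr ⟨ξ, hξ, rfl⟩) (-t) (by linarith)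
  rw [abs_neg] at c d
  rw [norm_neg] at d
  refine ⟨?_, ?_, ?_, d⟩
  · rw [← a, neg_neg]
  · rw [← b, neg_neg]
  · have : (2 * -t) • -ξ = (2 * t) • ξ := by module
    rwa [this] at c
end
end

section
/- Let n ≥ 2, μ ∈ (1/2, 1], let V be a potential of long-range order μ on ℝ^n, fix λ > 0, let Y be an eikonal phase for V, and set K(x) := √λ |x| − Y(x, λ). Let A ∈ C^∞(ℝ^n∖{0}) be positively homogeneous of degree 0 (A(cx) = A(x) for all c > 0), and let η be a cutoff at level κ with κ > R₀({λ}), so that the eikonal equation |∇K(x)|² + V(x) = λ holds wherever η(|x|) ≠ 0. Define u_±(x) := η(|x|) A(x) |x|^{-(n-1)/2} e^{±iK(x)} for x ≠ 0 and u_±(0) := 0. Then u_± ∈ B*(ℝ^n), u_± is smooth, and there exists l > 1/2 such that the function g_± := (−Δ + V − λ) u_± (classical derivatives) belongs to L^{2,l}(ℝ^n). -/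
open MeasureTheory Metric Filter
open scoped ENNReal RealInnerProductSpace Topology

noncomputable section

/-- The (classical, coordinatewise) Laplacian of `u : ℝ^n → ℂ`. -/
def lap (n : ℕ) (u : Euc n → ℂ) (x : Euc n) : ℂ :=
  ∑ i : Fin n,
    fderiv ℝ (fun y => fderiv ℝ u y (EuclideanSpace.single i 1)) x (EuclideanSpace.single i 1)

/-- The operator `(−Δ + V − λ)` applied classically to `v`. -/
def HOp (n : ℕ) (V : Euc n → ℝ) (lam : ℝ) (v : Euc n → ℂ) (x : Euc n) : ℂ :=
  -(lap n v x) + ((V x - lam : ℝ) : ℂ) * v x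

/-- The outgoing/incoming amplitude wave
`u_±(x) = η(|x|) A(x) |x|^{-(n-1)/2} e^{± i K(x)}` (sign `ε = ±1`). -/
def ampWave (n : ℕ) (Y : Euc n → ℝ → ℝ) (lam : ℝ) (A : Euc n → ℂ) (η : ℝ → ℝ) (ε : ℝ)
    (x : Euc n) : ℂ :=
  (η ‖x‖ : ℂ) * A x * ((‖x‖ ^ (-((n : ℝ) - 1) / 2) : ℝ) : ℂ) *
    Complex.exp ((ε : ℂ) * Complex.I * ((Kfun n Y lam x : ℝ) : ℂ))

lemma two_le_top' : (2 : WithTop ℕ∞) ≤ ((⊤ : ℕ∞) : WithTop ℕ∞) :=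
  WithTop.coe_le_coe.2 (le_top : (2 : ℕ∞) ≤ ⊤)

lemma hom_bound {n : ℕ} (f : Euc n → ℂ) (s κ : ℝ) (hs : s ≤ 0) (hκ : 0 < κ)
    (hf : ContinuousOn f {x : Euc n | x ≠ 0})
    (hh : ∀ c : ℝ, 0 < c → ∀ x, f (c • x) = (c ^ s : ℝ) • f x) :
    ∃ C : ℝ, 0 ≤ C ∧ ∀ x : Euc n, κ < ‖x‖ → ‖f x‖ ≤ C * (1 + ‖x‖) ^ s := by
  obtain ⟨C, hC⟩ := (isCompact_sphere (0 : Euc n) 1).exists_bound_of_continuousOn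
    (hf.mono (fun x hx => by
      simp only [mem_sphere_iff_norm, sub_zero] at hx
      simp only [Set.mem_ofPred_eq]
      rintro rfl
      simp at hx))
  refine ⟨|C| * (κ / (1 + κ)) ^ s, by positivity, fun x hx => ?_⟩
  have hx0 : 0 < ‖x‖ := hκ.trans hx
  have h1 : f x = ((‖x‖ ^ s : ℝ)) • f (‖x‖⁻¹ • x) := by
    rw [← hh _ hx0, smul_smul, mul_inv_cancel₀ hx0.ne', one_smul]
  have h2 : ‖f (‖x‖⁻¹ • x)‖ ≤ C := by
    apply hC
    simp [norm_smul, hx0.ne']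
  have h3 : κ / (1 + κ) * (1 + ‖x‖) ≤ ‖x‖ := by
    rw [div_mul_eq_mul_div, div_le_iff₀ (by positivity)]
    nlinarith
  have h4 : ‖x‖ ^ s ≤ (κ / (1 + κ)) ^ s * (1 + ‖x‖) ^ s := by
    rw [← Real.mul_rpow (by positivity) (by positivity)]
    exact Real.rpow_le_rpow_of_nonpos (by positivity) h3 hs
  rw [h1, norm_smul, Real.norm_of_nonneg (by positivity)]
  calc _ ≤ ((κ / (1 + κ)) ^ s * (1 + ‖x‖) ^ s) * |C| := by
        gcongr
        exact h2.trans (le_abs_self C)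
    _ = _ := by ring

lemma hom_deriv {n : ℕ} (f : Euc n → ℂ) (s : ℝ) (v : Euc n)
    (hh : ∀ c : ℝ, 0 < c → ∀ x, f (c • x) = (c ^ s : ℝ) • f x) :
    ∀ c : ℝ, 0 < c → ∀ x, fderiv ℝ f (c • x) v = (c ^ (s - 1) : ℝ) • fderiv ℝ f x v := by
  intro c hc x
  have h1 : fderiv ℝ (fun x => f (c • x)) x = c • fderiv ℝ f (c • x) := fderiv_comp_smul ..
  have h2 : (fun x => f (c • x)) = fun x => (c ^ s : ℝ) • f x := funext (hh c hc)
  have h3 : fderiv ℝ (fun x => (c ^ s : ℝ) • f x) x = (c ^ s : ℝ) • fderiv ℝ f x := by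
    have hne : (c ^ s : ℝ) ≠ 0 := by positivity
    exact congrFun (fderiv_const_smul_field (𝕜 := ℝ) (c ^ s : ℝ) (f := f)) x
  rw [h2, h3] at h1
  have h4 := congrArg (fun L => L v) h1
  simp only [smul_apply] at h4
  rw [Real.rpow_sub hc, Real.rpow_one, div_eq_inv_mul, mul_smul, h4, smul_smul,
    inv_mul_cancel₀ hc.ne', one_smul]

lemma euler {n : ℕ} (f : Euc n → ℂ) (s : ℝ) (x : Euc n) (hd : DifferentiableAt ℝ f x)
    (hh : ∀ c : ℝ, 0 < c → ∀ x, f (c • x) = (c ^ s : ℝ) • f x) :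
    fderiv ℝ f x x = (s : ℂ) * f x := by
  have h1 : HasDerivAt (fun c : ℝ => f (c • x)) (fderiv ℝ f x x) 1 := by
    have h := ((hasDerivAt_id (1:ℝ)).smul_const x)
    have hd' : HasFDerivAt f (fderiv ℝ f x) ((1:ℝ) • x) := by
      rw [one_smul]; exact hd.hasFDerivAt
    have := hd'.comp_hasDerivAt (1:ℝ) h
    simpa [Function.comp_def] using this
  have h2 : HasDerivAt (fun c : ℝ => (c ^ s : ℝ) • f x) ((s : ℝ) • f x) 1 := by
    have := (Real.hasDerivAt_rpow_const (x := 1) (p := s) (Or.inl one_ne_zero)).smul_const (f x)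
    simpa using this
  have h3 : HasDerivAt (fun c : ℝ => f (c • x)) ((s : ℝ) • f x) 1 := by
    refine h2.congr_of_eventuallyEq ?_
    filter_upwards [lt_mem_nhds (zero_lt_one (α := ℝ))] with c hc
    exact hh c hc x
  rw [h1.unique h3]; simp

lemma global_bound {n : ℕ} (g : Euc n → ℂ) (hg : Continuous g) (s R : ℝ)
    (h : ∃ C : ℝ, ∀ x : Euc n, R < ‖x‖ → ‖g x‖ ≤ C * (1 + ‖x‖) ^ s) :
    ∃ C : ℝ, 0 ≤ C ∧ ∀ x : Euc n, ‖g x‖ ≤ C * (1 + ‖x‖) ^ s := by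
  obtain ⟨C, hC⟩ := h
  have hc : Continuous (fun x : Euc n => ‖g x‖ * (1 + ‖x‖) ^ (-s)) := by
    refine hg.norm.mul ?_
    refine (continuous_const.add continuous_norm).rpow_const (fun x => Or.inl ?_)
    exact (by positivity : 0 < 1 + ‖x‖).ne'
  obtain ⟨D, hD⟩ := (isCompact_closedBall (0 : Euc n) R).exists_bound_of_continuousOn
    hc.continuousOn
  refine ⟨|C| + |D|, by positivity, fun x => ?_⟩
  have hp : 0 < (1 + ‖x‖) ^ s := by positivity
  by_cases hx : R < ‖x‖
  · refine (hC x hx).trans ?_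
    gcongr
    exact (le_abs_self C).trans (by linarith [abs_nonneg D])
  · have := (le_abs_self _).trans (hD x (by simpa using not_lt.1 hx))
    rw [Real.rpow_neg (by positivity), ← div_eq_mul_inv, div_le_iff₀ hp] at this
    refine this.trans ?_
    gcongr
    exact (le_abs_self D).trans (by linarith [abs_nonneg C])

lemma l2_bound {n : ℕ} (g : Euc n → ℂ) (l s C : ℝ) (hC : 0 ≤ C)
    (hs : 2 * l + 2 * s < -n) (h : ∀ x : Euc n, ‖g x‖ ≤ C * (1 + ‖x‖) ^ s) :
    (∫⁻ x : Euc n, ENNReal.ofReal ((1 + ‖x‖) ^ (2 * l)) *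
          (‖g x‖₊ : ℝ≥0∞) ^ 2) ≠ ⊤ := by
  have hi := finite_integral_one_add_norm (E := Euc n) (μ := volume)
    (r := -(2 * l + 2 * s)) (by simp; linarith)
  have hle : (∫⁻ x : Euc n, ENNReal.ofReal ((1 + ‖x‖) ^ (2 * l)) * (‖g x‖₊ : ℝ≥0∞) ^ 2)
      ≤ ∫⁻ x : Euc n, ENNReal.ofReal (C ^ 2) *
        ENNReal.ofReal ((1 + ‖x‖) ^ (-(-(2 * l + 2 * s)))) := by
    refine lintegral_mono (fun x => ?_)
    have : ((‖g x‖₊ : ℝ≥0∞)) = ENNReal.ofReal ‖g x‖ := (ofReal_norm _).symm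
    rw [this, ← ENNReal.ofReal_pow (norm_nonneg _), ← ENNReal.ofReal_mul (by positivity),
      ← ENNReal.ofReal_mul (by positivity)]
    apply ENNReal.ofReal_le_ofReal
    have hx : 0 < 1 + ‖x‖ := by positivity
    calc (1 + ‖x‖) ^ (2 * l) * ‖g x‖ ^ 2
        ≤ (1 + ‖x‖) ^ (2 * l) * (C * (1 + ‖x‖) ^ s) ^ 2 := by
          gcongr
          exact h x
      _ = _ := by
          rw [neg_neg, Real.rpow_add hx, mul_comm 2 s, Real.rpow_mul hx.le s 2]
          norm_cast
          ring
  refine ne_top_of_le_ne_top ?_ hle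
  rw [lintegral_const_mul' _ _ ENNReal.ofReal_ne_top]
  exact ENNReal.mul_ne_top ENNReal.ofReal_ne_top hi.ne

lemma shell_sub (n j : ℕ) : AHshell n j ⊆ Metric.ball 0 ((2:ℝ) ^ j) := by
  intro x hx
  unfold AHshell at hx
  split_ifs at hx with h
  · subst h; simpa using hx
  · simpa using hx.2

lemma shell_low (n j : ℕ) (x : Euc n) (hx : x ∈ AHshell n j) :
    (2:ℝ) ^ ((j:ℝ) - 1) ≤ 1 + ‖x‖ := by
  unfold AHshell at hx
  split_ifs at hx with h
  · subst h
    have : (2:ℝ) ^ (((0:ℕ):ℝ) - 1) ≤ 1 := Real.rpow_le_one_of_one_le_of_nonpos (by norm_num) (by simp)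
    linarith [norm_nonneg x]
  · have h1 := hx.1
    rw [← Real.rpow_natCast, Nat.cast_sub (Nat.one_le_iff_ne_zero.2 h)] at h1
    push_cast at h1
    linarith

lemma bstar_bound {n : ℕ} (hn : 2 ≤ n) (u : Euc n → ℂ) (C : ℝ) (hC : 0 ≤ C)
    (h : ∀ x : Euc n, ‖u x‖ ≤ C * (1 + ‖x‖) ^ (-((n : ℝ) - 1) / 2)) :
    BStarNorm n u ≠ ⊤ := by
  have hd : -((n : ℝ) - 1) / 2 ≤ 0 := by
    have : (2:ℝ) ≤ n := by exact_mod_cast hn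
    linarith
  set d := -((n : ℝ) - 1) / 2 with hdd
  set v := volume (Metric.ball (0 : Euc n) 1) with hv
  have hvt : v ≠ ⊤ := measure_ball_lt_top.ne
  have key : ∀ j : ℕ, (2 : ℝ≥0∞) ^ (-(j : ℝ) / 2) *
      eLpNorm u 2 (volume.restrict (AHshell n j)) ≤
      v ^ (1/2 : ℝ) * ENNReal.ofReal (C * 2 ^ (-d)) := by
    intro j
    have hms : MeasurableSet (AHshell n j) := by
      unfold AHshell
      split_ifs
      · exact measurableSet_ball
      · exact (measurableSet_lt measurable_const measurable_norm).inter
          (measurableSet_lt measurable_norm measurable_const)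
    have h1 := eLpNorm_le_of_ae_bound (p := 2) (μ := volume.restrict (AHshell n j)) (f := u)
      (C := C * ((2:ℝ) ^ ((j:ℝ) - 1)) ^ d) (by
        filter_upwards [ae_restrict_mem hms] with x hx
        refine (h x).trans ?_
        gcongr ?_ * ?_
        exact Real.rpow_le_rpow_of_nonpos (by positivity) (shell_low n j x hx) hd)
    have h2 : (volume.restrict (AHshell n j)) Set.univ ≤ ENNReal.ofReal ((2:ℝ) ^ (j * n)) * v := by
      rw [Measure.restrict_apply_univ]
      refine (measure_mono (shell_sub n j)).trans ?_
      rw [Measure.addHaar_ball_of_pos _ _ (by positivity)]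
      simp [pow_mul, hv]
    have h3 : (2 : ℝ≥0∞) = ENNReal.ofReal 2 := by simp
    calc _ ≤ (2 : ℝ≥0∞) ^ (-(j : ℝ) / 2) * ((ENNReal.ofReal ((2:ℝ) ^ (j * n)) * v) ^ (1/2 : ℝ)
          * ENNReal.ofReal (C * ((2:ℝ) ^ ((j:ℝ) - 1)) ^ d)) := by
          gcongr
          refine h1.trans ?_
          gcongr
          simp only [ENNReal.toReal_ofNat, one_div]
          gcongr
      _ = _ := by
          rw [ENNReal.mul_rpow_of_nonneg _ _ (by norm_num), h3,
            ENNReal.ofReal_rpow_of_pos (by norm_num), ENNReal.ofReal_rpow_of_pos (by positivity)]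
          have : ∀ a b c w : ℝ≥0∞, a * (b * w * c) = w * (a * b * c) := by intros; ring
          rw [this, ← ENNReal.ofReal_mul (by positivity), ← ENNReal.ofReal_mul (by positivity)]
          congr 2
          rw [← Real.rpow_natCast, ← Real.rpow_mul (by norm_num), ← Real.rpow_mul (by norm_num),
            ← Real.rpow_add (by norm_num)]
          rw [mul_left_comm, ← Real.rpow_add (by norm_num)]
          congr 2
          push_cast
          rw [hdd]; ring
  refine ne_top_of_le_ne_top ?_ (iSup_le key)
  exact ENNReal.mul_ne_top (ENNReal.rpow_ne_top_of_nonneg (by norm_num) hvt) ENNReal.ofReal_ne_top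

lemma d1_prod {n : ℕ} (w : Euc n → ℂ) (K : Euc n → ℝ) (b : ℂ) (y v : Euc n)
    (hw : DifferentiableAt ℝ w y) (hK : DifferentiableAt ℝ K y) :
    fderiv ℝ (fun y => w y * Complex.exp (b * ((K y : ℝ) : ℂ))) y v =
      (fderiv ℝ w y v + b * w y * ((fderiv ℝ K y v : ℝ) : ℂ)) *
        Complex.exp (b * ((K y : ℝ) : ℂ)) := by
  have h1 : HasFDerivAt (fun y => ((K y : ℝ) : ℂ))
      (Complex.ofRealCLM.comp (fderiv ℝ K y)) y :=
    Complex.ofRealCLM.hasFDerivAt.comp y hK.hasFDerivAt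
  have h2 := (h1.const_mul b).cexp
  have h3 := hw.hasFDerivAt.fun_mul h2
  rw [HasFDerivAt.fderiv h3]
  simp
  ring

lemma cd_dir {n : ℕ} {F : Type*} [NormedAddCommGroup F] [NormedSpace ℝ F]
    (f : Euc n → F) (x v : Euc n) (h : ContDiffAt ℝ 2 f x) :
    ContDiffAt ℝ 1 (fun y => fderiv ℝ f y v) x :=
  (h.fderiv_right (m := 1) (by norm_num)).clm_apply contDiffAt_const

lemma d2_prod {n : ℕ} (w : Euc n → ℂ) (K : Euc n → ℝ) (b : ℂ) (x v : Euc n)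
    (hw : ContDiffAt ℝ 2 w x) (hK : ContDiffAt ℝ 2 K x) :
    fderiv ℝ (fun y => fderiv ℝ (fun y => w y * Complex.exp (b * ((K y : ℝ) : ℂ))) y v) x v =
      (fderiv ℝ (fun y => fderiv ℝ w y v) x v
        + 2 * b * (fderiv ℝ w x v * ((fderiv ℝ K x v : ℝ) : ℂ))
        + b * w x * ((fderiv ℝ (fun y => fderiv ℝ K y v) x v : ℝ) : ℂ)
        + b ^ 2 * w x * (((fderiv ℝ K x v) ^ 2 : ℝ) : ℂ)) *
        Complex.exp (b * ((K x : ℝ) : ℂ)) := by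
  have hev : (fun y => fderiv ℝ (fun y => w y * Complex.exp (b * ((K y : ℝ) : ℂ))) y v) =ᶠ[𝓝 x]
      fun y => (fderiv ℝ w y v + b * w y * ((fderiv ℝ K y v : ℝ) : ℂ)) *
        Complex.exp (b * ((K y : ℝ) : ℂ)) := by
    filter_upwards [hw.eventually (by simp), hK.eventually (by simp)] with y h1 h2
    exact d1_prod w K b y v (h1.differentiableAt (by norm_num)) (h2.differentiableAt (by norm_num))
  have dw := (hw.differentiableAt (by norm_num)).hasFDerivAt
  have dw' := ((cd_dir w x v hw).differentiableAt (by norm_num)).hasFDerivAt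
  have dK := hK.differentiableAt (n := 2) (by norm_num)
  have dK' := ((cd_dir K x v hK).differentiableAt (by norm_num)).hasFDerivAt
  have h1 : HasFDerivAt (fun y => ((fderiv ℝ K y v : ℝ) : ℂ)) _ x :=
    Complex.ofRealCLM.hasFDerivAt.comp x dK'
  have h2 := dw'.add ((dw.const_mul b).mul h1)
  rw [hev.fderiv_eq]
  have h3 := d1_prod (fun y => fderiv ℝ w y v + b * w y * ((fderiv ℝ K y v : ℝ) : ℂ)) K b x v
    h2.differentiableAt dK
  rw [h3]
  have h4 : fderiv ℝ (fun y => fderiv ℝ w y v + b * w y * ((fderiv ℝ K y v : ℝ) : ℂ)) x = _ :=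
    HasFDerivAt.fderiv h2
  rw [h4]
  simp
  ring

lemma norm_d1 {n : ℕ} (y v : Euc n) (hy : y ≠ 0) :
    fderiv ℝ (fun z : Euc n => ‖z‖) y v = ⟪y, v⟫ / ‖y‖ := by
  have hd : DifferentiableAt ℝ (fun z : Euc n => ‖z‖) y :=
    (contDiffAt_norm ℝ hy (n := 1)).differentiableAt (by norm_num)
  have h1 := hd.hasFDerivAt.pow 2
  have h2 := (hasStrictFDerivAt_norm_sq y).hasFDerivAt
  have h3 := congrArg (fun L => L v) (h1.unique h2)
  simp at h3
  have : ‖y‖ ≠ 0 := norm_ne_zero_iff.2 hy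
  field_simp
  linarith

lemma norm_d2 {n : ℕ} (y v : Euc n) (hy : y ≠ 0) :
    fderiv ℝ (fun z => fderiv ℝ (fun z : Euc n => ‖z‖) z v) y v =
      ‖v‖ ^ 2 / ‖y‖ - ⟪y, v⟫ ^ 2 / ‖y‖ ^ 3 := by
  have hev : (fun z => fderiv ℝ (fun z : Euc n => ‖z‖) z v) =ᶠ[𝓝 y]
      fun z => ⟪z, v⟫ * ‖z‖⁻¹ := by
    filter_upwards [isOpen_ne.mem_nhds hy] with z hz
    rw [norm_d1 z v hz, div_eq_mul_inv]
  have hd : DifferentiableAt ℝ (fun z : Euc n => ‖z‖) y :=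
    (contDiffAt_norm ℝ hy (n := 1)).differentiableAt (by norm_num)
  have hn : ‖y‖ ≠ 0 := norm_ne_zero_iff.2 hy
  have h1 : HasFDerivAt (fun z : Euc n => ⟪z, v⟫) _ y :=
    (hasFDerivAt_id y).inner ℝ (hasFDerivAt_const v y)
  have h2 : HasFDerivAt (fun z : Euc n => ‖z‖⁻¹) _ y :=
    (hasDerivAt_inv hn).comp_hasFDerivAt y hd.hasFDerivAt
  rw [hev.fderiv_eq, HasFDerivAt.fderiv (h1.fun_mul h2)]
  simp [norm_d1 y v hy, fderivInnerCLM_apply]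
  field_simp
  ring

lemma inner_single' {n : ℕ} (x : Euc n) (i : Fin n) :
    ⟪x, EuclideanSpace.single i (1:ℝ)⟫ = x i := by
  simp [EuclideanSpace.inner_single_right]

lemma expand {n : ℕ} {F : Type*} [NormedAddCommGroup F] [NormedSpace ℝ F]
    (L : Euc n →L[ℝ] F) (x : Euc n) :
    L x = ∑ i, x i • L (EuclideanSpace.single i 1) := by
  conv_lhs => rw [← (EuclideanSpace.basisFun (Fin n) ℝ).sum_repr x]
  simp

lemma grad_sq {n : ℕ} (K : Euc n → ℝ) (x : Euc n) :
    ‖gradient K x‖ ^ 2 = ∑ i, (fderiv ℝ K x (EuclideanSpace.single i 1)) ^ 2 := by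
  rw [EuclideanSpace.real_norm_sq_eq]
  refine Finset.sum_congr rfl fun i _ => ?_
  rw [← inner_single']
  congr 1
  simp [gradient]

lemma Y_smooth {n : ℕ} {μ : ℝ} {V : Euc n → ℝ} {Y : Euc n → ℝ → ℝ} (hY : IsEikonalPhase n μ V Y)
    {lam : ℝ} (hlam : 0 < lam) : ContDiff ℝ (⊤ : ℕ∞) (fun y => Y y lam) := by
  rw [← contDiffOn_univ]
  exact hY.1.comp (f := fun y : Euc n => (y, lam)) (by fun_prop) (fun y _ => by simpa using hlam)

lemma Y_b1 {n : ℕ} {μ : ℝ} {V : Euc n → ℝ} {Y : Euc n → ℝ → ℝ} (hY : IsEikonalPhase n μ V Y)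
    {lam : ℝ} (hlam : 0 < lam) : ∃ C > 0, ∀ (x : Euc n) (i : Fin n),
      |fderiv ℝ (fun y => Y y lam) x (EuclideanSpace.single i 1)| ≤ C * (1 + ‖x‖) ^ (-μ) := by
  obtain ⟨C, hC, h⟩ := hY.2.2 1 0 {lam} isCompact_singleton (by simpa using hlam)
  refine ⟨C, hC, fun x i => ?_⟩
  have := h x lam rfl
  simp only [iteratedDerivWithin_zero, norm_iteratedFDeriv_one] at this
  have h2 := (fderiv ℝ (fun y => Y y lam) x).le_opNorm (EuclideanSpace.single i 1)
  simp only [EuclideanSpace.norm_single, norm_one, mul_one, Real.norm_eq_abs] at h2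
  refine h2.trans (this.trans (le_of_eq ?_))
  congr 2; push_cast; ring

lemma Y_b2 {n : ℕ} {μ : ℝ} {V : Euc n → ℝ} {Y : Euc n → ℝ → ℝ} (hY : IsEikonalPhase n μ V Y)
    {lam : ℝ} (hlam : 0 < lam) : ∃ C > 0, ∀ (x : Euc n) (i : Fin n),
      |fderiv ℝ (fun y => fderiv ℝ (fun y => Y y lam) y (EuclideanSpace.single i 1)) x
        (EuclideanSpace.single i 1)| ≤ C * (1 + ‖x‖) ^ (-1 - μ) := by
  obtain ⟨C, hC, h⟩ := hY.2.2 2 0 {lam} isCompact_singleton (by simpa using hlam)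
  refine ⟨C, hC, fun x i => ?_⟩
  have := h x lam rfl
  simp only [iteratedDerivWithin_zero] at this
  have h2 := (iteratedFDeriv ℝ 2 (fun y => Y y lam) x).le_opNorm
    (fun _ => EuclideanSpace.single i 1)
  rw [iteratedFDeriv_two_apply] at h2
  simp only [EuclideanSpace.norm_single, norm_one, mul_one, Real.norm_eq_abs,
    Finset.prod_const_one] at h2
  have hd : DifferentiableAt ℝ (fderiv ℝ (fun y => Y y lam)) x :=
    ((((Y_smooth hY hlam).of_le (m := 2) two_le_top').fderiv_right (m := 1)
      (by norm_num)).differentiable (by norm_num)) x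
  rw [fderiv_clm_apply hd (differentiableAt_const _)]
  simp only [fderiv_fun_const, Pi.zero_apply, ContinuousLinearMap.comp_zero, zero_add,
    ContinuousLinearMap.flip_apply]
  refine h2.trans (this.trans (le_of_eq ?_))
  congr 2; push_cast; ring

lemma K_d1 {n : ℕ} (Y : Euc n → ℝ → ℝ) (lam : ℝ) (x v : Euc n) (hx : x ≠ 0)
    (hY : DifferentiableAt ℝ (fun y => Y y lam) x) :
    fderiv ℝ (Kfun n Y lam) x v =
      Real.sqrt lam * (⟪x, v⟫ / ‖x‖) - fderiv ℝ (fun y => Y y lam) x v := by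
  have hd : DifferentiableAt ℝ (fun z : Euc n => ‖z‖) x :=
    (contDiffAt_norm ℝ hx (n := 1)).differentiableAt (by norm_num)
  have h : HasFDerivAt (Kfun n Y lam) _ x :=
    (hd.hasFDerivAt.const_mul (Real.sqrt lam)).fun_sub hY.hasFDerivAt
  rw [h.fderiv]
  simp [norm_d1 x v hx]

lemma K_cd {n : ℕ} (Y : Euc n → ℝ → ℝ) (lam : ℝ) (x : Euc n) (hx : x ≠ 0) (m : WithTop ℕ∞)
    (hY : ContDiffAt ℝ m (fun y => Y y lam) x) :
    ContDiffAt ℝ m (Kfun n Y lam) x :=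
  (contDiffAt_const.mul (contDiffAt_norm ℝ hx)).sub hY

lemma K_d2 {n : ℕ} (Y : Euc n → ℝ → ℝ) (lam : ℝ) (x v : Euc n) (hx : x ≠ 0)
    (hY : ContDiffAt ℝ 2 (fun y => Y y lam) x) :
    fderiv ℝ (fun y => fderiv ℝ (Kfun n Y lam) y v) x v =
      Real.sqrt lam * (‖v‖ ^ 2 / ‖x‖ - ⟪x, v⟫ ^ 2 / ‖x‖ ^ 3)
        - fderiv ℝ (fun y => fderiv ℝ (fun y => Y y lam) y v) x v := by
  have hev : (fun y => fderiv ℝ (Kfun n Y lam) y v) =ᶠ[𝓝 x] fun y =>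
      Real.sqrt lam * fderiv ℝ (fun z : Euc n => ‖z‖) y v - fderiv ℝ (fun y => Y y lam) y v := by
    filter_upwards [isOpen_ne.mem_nhds hx, hY.eventually (by simp)] with z hz hz2
    rw [K_d1 Y lam z v hz (hz2.differentiableAt (by norm_num)), norm_d1 z v hz]
  have h1 := ((cd_dir (fun z : Euc n => ‖z‖) x v (contDiffAt_norm ℝ hx)).differentiableAt
    (by norm_num)).hasFDerivAt
  have h2 := ((cd_dir _ x v hY).differentiableAt (by norm_num)).hasFDerivAt
  rw [hev.fderiv_eq, HasFDerivAt.fderiv ((h1.const_mul (Real.sqrt lam)).fun_sub h2)]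
  simp [norm_d2 x v hx]

lemma HOp_formula {n : ℕ} (V : Euc n → ℝ) (Y : Euc n → ℝ → ℝ) (lam : ℝ) (w : Euc n → ℂ) (b : ℂ)
    (hb : b ^ 2 = -1) (x : Euc n) (hx : x ≠ 0)
    (hw : ContDiffAt ℝ 2 w x) (hY : ContDiffAt ℝ 2 (fun y => Y y lam) x)
    (hh : ∀ c : ℝ, 0 < c → ∀ x, w (c • x) = (c ^ (-((n : ℝ) - 1) / 2) : ℝ) • w x)
    (heik : ‖gradient (fun y => Kfun n Y lam y) x‖ ^ 2 + V x = lam) :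
    HOp n V lam (fun y => w y * Complex.exp (b * ((Kfun n Y lam y : ℝ) : ℂ))) x =
      -(∑ i : Fin n, (fderiv ℝ (fun y => fderiv ℝ w y (EuclideanSpace.single i 1)) x
          (EuclideanSpace.single i 1)
        - 2 * b * (fderiv ℝ w x (EuclideanSpace.single i 1) *
          ((fderiv ℝ (fun y => Y y lam) x (EuclideanSpace.single i 1) : ℝ) : ℂ))
        - b * w x * ((fderiv ℝ (fun y => fderiv ℝ (fun y => Y y lam) y
          (EuclideanSpace.single i 1)) x (EuclideanSpace.single i 1) : ℝ) : ℂ))) *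
        Complex.exp (b * ((Kfun n Y lam x : ℝ) : ℂ)) := by
  have hr : ‖x‖ ≠ 0 := norm_ne_zero_iff.2 hx
  have hrc : (‖x‖ : ℂ) ≠ 0 := by exact_mod_cast hr
  have hE := euler w _ x (hw.differentiableAt (by norm_num)) hh
  rw [expand] at hE
  have hg : (∑ i, (((fderiv ℝ (Kfun n Y lam) x (EuclideanSpace.single i 1)) ^ 2 : ℝ) : ℂ)) =
      ((lam - V x : ℝ) : ℂ) := by
    rw [← Complex.ofReal_sum, ← grad_sq]
    congr 1
    change ‖gradient (fun y => Kfun n Y lam y) x‖ ^ 2 = _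
    linarith
  have hns : (∑ i, ((x i : ℝ) : ℂ) ^ 2) = (‖x‖ : ℂ) ^ 2 := by
    have := EuclideanSpace.real_norm_sq_eq x
    exact_mod_cast this.symm
  unfold HOp lap
  simp_rw [d2_prod w (Kfun n Y lam) b x _ hw (K_cd Y lam x hx 2 hY)]
  rw [← Finset.sum_mul]
  have hsum : ∑ i : Fin n, (fderiv ℝ (fun y => fderiv ℝ w y (EuclideanSpace.single i 1)) x
          (EuclideanSpace.single i 1)
        + 2 * b * (fderiv ℝ w x (EuclideanSpace.single i 1) *
          ((fderiv ℝ (Kfun n Y lam) x (EuclideanSpace.single i 1) : ℝ) : ℂ))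
        + b * w x * ((fderiv ℝ (fun y => fderiv ℝ (Kfun n Y lam) y
            (EuclideanSpace.single i 1)) x (EuclideanSpace.single i 1) : ℝ) : ℂ)
        + b ^ 2 * w x * (((fderiv ℝ (Kfun n Y lam) x (EuclideanSpace.single i 1)) ^ 2 : ℝ) : ℂ)) =
      (∑ i : Fin n, (fderiv ℝ (fun y => fderiv ℝ w y (EuclideanSpace.single i 1)) x
          (EuclideanSpace.single i 1)
        - 2 * b * (fderiv ℝ w x (EuclideanSpace.single i 1) *
          ((fderiv ℝ (fun y => Y y lam) x (EuclideanSpace.single i 1) : ℝ) : ℂ))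
        - b * w x * ((fderiv ℝ (fun y => fderiv ℝ (fun y => Y y lam) y
          (EuclideanSpace.single i 1)) x (EuclideanSpace.single i 1) : ℝ) : ℂ)))
        - ((lam - V x : ℝ) : ℂ) * w x := by
    rw [Finset.sum_add_distrib, ← Finset.mul_sum, hg, hb]
    have h0 : ∀ i : Fin n, fderiv ℝ (fun y => fderiv ℝ w y (EuclideanSpace.single i 1)) x
          (EuclideanSpace.single i 1)
        + 2 * b * (fderiv ℝ w x (EuclideanSpace.single i 1) *
          ((fderiv ℝ (Kfun n Y lam) x (EuclideanSpace.single i 1) : ℝ) : ℂ))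
        + b * w x * ((fderiv ℝ (fun y => fderiv ℝ (Kfun n Y lam) y
            (EuclideanSpace.single i 1)) x (EuclideanSpace.single i 1) : ℝ) : ℂ) =
        (fderiv ℝ (fun y => fderiv ℝ w y (EuclideanSpace.single i 1)) x
          (EuclideanSpace.single i 1)
        - 2 * b * (fderiv ℝ w x (EuclideanSpace.single i 1) *
          ((fderiv ℝ (fun y => Y y lam) x (EuclideanSpace.single i 1) : ℝ) : ℂ))
        - b * w x * ((fderiv ℝ (fun y => fderiv ℝ (fun y => Y y lam) y
          (EuclideanSpace.single i 1)) x (EuclideanSpace.single i 1) : ℝ) : ℂ))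
        + (2 * b * (Real.sqrt lam : ℂ) * (‖x‖ : ℂ)⁻¹) *
            (x i • fderiv ℝ w x (EuclideanSpace.single i 1))
        + (b * w x * (Real.sqrt lam : ℂ) * (‖x‖ : ℂ)⁻¹)
        - (b * w x * (Real.sqrt lam : ℂ) * ((‖x‖ : ℂ) ^ 3)⁻¹) * ((x i : ℝ) : ℂ) ^ 2 := by
      intro i
      rw [K_d1 Y lam x _ hx (hY.differentiableAt (by norm_num)), K_d2 Y lam x _ hx hY,
        inner_single']
      have : ‖(EuclideanSpace.single i (1:ℝ) : Euc n)‖ = 1 := by simp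
      rw [this]
      push_cast
      rw [Complex.real_smul]
      ring
    rw [Finset.sum_congr rfl (fun i _ => h0 i), Finset.sum_sub_distrib, Finset.sum_add_distrib,
      Finset.sum_add_distrib, ← Finset.mul_sum, hE,
      ← Finset.mul_sum Finset.univ (fun i => ((x i : ℝ) : ℂ) ^ 2), hns]
    generalize (∑ i : Fin n, (_ - _ - _) : ℂ) = S
    simp only [Finset.sum_const, Finset.card_univ, Fintype.card_fin, nsmul_eq_mul]
    push_cast
    field_simp
    ring
  rw [hsum]
  push_cast
  ring

lemma amp_smooth {n : ℕ} (Y : Euc n → ℝ → ℝ) (lam : ℝ)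
    (hY : ContDiff ℝ (⊤ : ℕ∞) (fun y => Y y lam))
    (A : Euc n → ℂ) (hA : ContDiffOn ℝ (⊤ : ℕ∞) A {x : Euc n | x ≠ 0})
    (η : ℝ → ℝ) (κ : ℝ) (hκ : 0 < κ) (hη : ContDiff ℝ (⊤ : ℕ∞) η)
    (hη0 : ∀ t : ℝ, t < κ → η t = 0) (ε : ℝ) :
    ContDiff ℝ (⊤ : ℕ∞) (ampWave n Y lam A η ε) := by
  rw [contDiff_iff_contDiffAt]
  intro x
  by_cases hx : x = 0
  · have : ampWave n Y lam A η ε =ᶠ[𝓝 x] fun _ => 0 := by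
      subst hx
      filter_upwards [Metric.ball_mem_nhds (0 : Euc n) hκ] with y hy
      simp [ampWave, hη0 ‖y‖ (by simpa using hy)]
    exact contDiffAt_const.congr_of_eventuallyEq this
  · have hN : ContDiffAt ℝ (⊤ : ℕ∞) (fun y : Euc n => ‖y‖) x := contDiffAt_norm ℝ hx
    have h1 : ContDiffAt ℝ (⊤ : ℕ∞) (fun y : Euc n => ((η ‖y‖ : ℝ) : ℂ)) x :=
      Complex.ofRealCLM.contDiff.contDiffAt.comp x (hη.contDiffAt.comp x hN)
    have h2 : ContDiffAt ℝ (⊤ : ℕ∞) A x := hA.contDiffAt (isOpen_ne.mem_nhds hx)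
    have h3 : ContDiffAt ℝ (⊤ : ℕ∞)
        (fun y : Euc n => ((‖y‖ ^ (-((n : ℝ) - 1) / 2) : ℝ) : ℂ)) x :=
      Complex.ofRealCLM.contDiff.contDiffAt.comp x
        (hN.rpow_const_of_ne (norm_ne_zero_iff.2 hx))
    have h4 : ContDiffAt ℝ (⊤ : ℕ∞) (fun y : Euc n => ((Kfun n Y lam y : ℝ) : ℂ)) x :=
      Complex.ofRealCLM.contDiff.contDiffAt.comp x (K_cd Y lam x hx _ hY.contDiffAt)
    exact ((h1.mul h2).mul h3).mul (contDiffAt_const.mul h4).cexp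

lemma HOp_congr {n : ℕ} (V : Euc n → ℝ) (lam : ℝ) (u v : Euc n → ℂ) (x : Euc n)
    (h : u =ᶠ[𝓝 x] v) : HOp n V lam u x = HOp n V lam v x := by
  unfold HOp lap
  rw [h.eq_of_nhds]
  congr 2
  refine Finset.sum_congr rfl fun i _ => ?_
  have : (fun y => fderiv ℝ u y (EuclideanSpace.single i 1)) =ᶠ[𝓝 x]
      (fun y => fderiv ℝ v y (EuclideanSpace.single i 1)) := by
    filter_upwards [h.fderiv (𝕜 := ℝ)] with y hy
    rw [hy]
  rw [this.fderiv_eq]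

lemma HOp_cont {n : ℕ} (V : Euc n → ℝ) (hV : Continuous V) (lam : ℝ) (u : Euc n → ℂ)
    (hu : ContDiff ℝ (⊤ : ℕ∞) u) : Continuous (HOp n V lam u) := by
  unfold HOp lap
  refine Continuous.add (Continuous.neg (continuous_finset_sum _ fun i _ => ?_)) ?_
  · have h2 : ContDiff ℝ 2 u := hu.of_le two_le_top'
    have h1 : ContDiff ℝ 1 (fun y => fderiv ℝ u y (EuclideanSpace.single i 1)) :=
      contDiff_iff_contDiffAt.2 fun x => cd_dir u x _ h2.contDiffAt
    exact (h1.continuous_fderiv (by norm_num)).clm_apply continuous_const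
  · exact (Complex.continuous_ofReal.comp (hV.sub continuous_const)).mul hu.continuous

/-- the cut-off spherical waves `u_± = η A |x|^{-(n-1)/2} e^{±iK}`
belong to `B*(ℝ^n)`, are smooth, and `(−Δ + V − λ)u_± ∈ L^{2,l}` for some `l > 1/2`. -/
theorem stmt6 (n : ℕ) (hn : 2 ≤ n) (μ : ℝ) (hμ0 : 1/2 < μ) (hμ1 : μ ≤ 1)
    (V : Euc n → ℝ) (hV : IsLongRangePotential n μ V)
    (lam : ℝ) (hlam : 0 < lam)
    (Y : Euc n → ℝ → ℝ) (hY : IsEikonalPhase n μ V Y)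
    (A : Euc n → ℂ) (hA : ContDiffOn ℝ (⊤ : ℕ∞) A {x : Euc n | x ≠ 0})
    (hAhom : ∀ c : ℝ, 0 < c → ∀ x : Euc n, A (c • x) = A x)
    (η : ℝ → ℝ) (κ : ℝ) (hκ : 0 < κ) (hη : ContDiff ℝ (⊤ : ℕ∞) η)
    (hη0 : ∀ t : ℝ, t < κ → η t = 0) (hη1 : ∀ t : ℝ, 2 * κ < t → η t = 1)
    (heik : ∀ x : Euc n, η ‖x‖ ≠ 0 →
      ‖gradient (fun y => Kfun n Y lam y) x‖ ^ 2 + V x = lam)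
    (ε : ℝ) (hε : ε = 1 ∨ ε = -1) :
    BStarNorm n (ampWave n Y lam A η ε) ≠ ⊤ ∧
    ContDiff ℝ (⊤ : ℕ∞) (ampWave n Y lam A η ε) ∧
    ∃ l : ℝ, 1/2 < l ∧
      (∫⁻ x : Euc n, ENNReal.ofReal ((1 + ‖x‖) ^ (2 * l)) *
          (‖HOp n V lam (ampWave n Y lam A η ε) x‖₊ : ℝ≥0∞) ^ 2) ≠ ⊤ := by
  have hYs := Y_smooth hY hlam
  have hsm := amp_smooth Y lam hYs A hA η κ hκ hη hη0 ε
  have hnr : (2:ℝ) ≤ n := by exact_mod_cast hn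
  set d : ℝ := -((n : ℝ) - 1) / 2 with hd
  have hd0 : d ≤ 0 := by rw [hd]; linarith
  set w : Euc n → ℂ := fun x => A x * ((‖x‖ ^ d : ℝ) : ℂ) with hwdef
  set b : ℂ := (ε : ℂ) * Complex.I with hb
  have hb2 : b ^ 2 = -1 := by
    rcases hε with h | h <;> simp [hb, h, mul_pow]
  have hbn : ‖b‖ = 1 := by
    rcases hε with h | h <;> simp [hb, h]
  have hbre : ∀ t : ℝ, ‖Complex.exp (b * (t : ℂ))‖ = 1 := by
    intro t
    rw [Complex.norm_exp]
    simp [hb]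
  have hw : ∀ c : ℝ, 0 < c → ∀ x, w (c • x) = (c ^ d : ℝ) • w x := by
    intro c hc x
    simp only [hwdef, hAhom c hc x, norm_smul, Real.norm_of_nonneg hc.le]
    rw [Real.mul_rpow hc.le (norm_nonneg _), Complex.real_smul]
    push_cast
    ring
  have hwc : ∀ x : Euc n, x ≠ 0 → ContDiffAt ℝ (⊤ : ℕ∞) w x := by
    intro x hx
    have h2 : ContDiffAt ℝ (⊤ : ℕ∞) A x := hA.contDiffAt (isOpen_ne.mem_nhds hx)
    have hN : ContDiffAt ℝ (⊤ : ℕ∞) (fun y : Euc n => ‖y‖) x := contDiffAt_norm ℝ hx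
    exact h2.mul (Complex.ofRealCLM.contDiff.contDiffAt.comp x
        (hN.rpow_const_of_ne (norm_ne_zero_iff.2 hx)))
  have hwc2 : ∀ x : Euc n, x ≠ 0 → ContDiffAt ℝ 2 w x := fun x hx =>
    (hwc x hx).of_le two_le_top'
  have hκ2 : 0 < 2 * κ := by linarith
  -- bounds
  obtain ⟨C0, hC0, hB0⟩ := hom_bound w d (2 * κ) hd0 hκ2
    (fun x hx => (hwc x hx).continuousAt.continuousWithinAt) hw
  have hB1' : ∀ i : Fin n, ∃ C : ℝ, 0 ≤ C ∧ ∀ x : Euc n, 2 * κ < ‖x‖ →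
      ‖fderiv ℝ w x (EuclideanSpace.single i 1)‖ ≤ C * (1 + ‖x‖) ^ (d - 1) := fun i =>
    hom_bound (fun x => fderiv ℝ w x (EuclideanSpace.single i 1)) (d - 1) (2 * κ)
      (by linarith) hκ2
      (fun x hx => (cd_dir w x _ (hwc2 x hx)).continuousAt.continuousWithinAt)
      (hom_deriv w d _ hw)
  have hB2' : ∀ i : Fin n, ∃ C : ℝ, 0 ≤ C ∧ ∀ x : Euc n, 2 * κ < ‖x‖ →
      ‖fderiv ℝ (fun y => fderiv ℝ w y (EuclideanSpace.single i 1)) x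
        (EuclideanSpace.single i 1)‖ ≤ C * (1 + ‖x‖) ^ (d - 1 - 1) := fun i =>
    hom_bound (fun x => fderiv ℝ (fun y => fderiv ℝ w y (EuclideanSpace.single i 1)) x
        (EuclideanSpace.single i 1)) (d - 1 - 1) (2 * κ)
      (by linarith) hκ2
      (fun x hx => ((((cd_dir w x (EuclideanSpace.single i 1) (hwc2 x hx)).fderiv_right (m := 0)
        (by norm_num)).clm_apply contDiffAt_const).continuousAt).continuousWithinAt)
      (hom_deriv _ (d - 1) _ (hom_deriv w d _ hw))
  choose C1 hC1 hB1 using hB1'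
  choose C2 hC2 hB2 using hB2'
  obtain ⟨D1, hD1, hY1⟩ := Y_b1 hY hlam
  obtain ⟨D2, hD2, hY2⟩ := Y_b2 hY hlam
  have hamp : ∀ x : Euc n, 2 * κ < ‖x‖ → ampWave n Y lam A η ε x =
      w x * Complex.exp (b * ((Kfun n Y lam x : ℝ) : ℂ)) := by
    intro x hx
    simp [ampWave, hη1 _ hx, hwdef, hb, hd]
  refine ⟨?_, hsm, 3/4, by norm_num, ?_⟩
  · obtain ⟨C, hC, h⟩ := global_bound (ampWave n Y lam A η ε) hsm.continuous d (2 * κ)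
      ⟨C0, fun x hx => by
        rw [hamp x hx, norm_mul, hbre, mul_one]
        exact hB0 x hx⟩
    exact bstar_bound hn _ C hC h
  · have hfar : ∀ x : Euc n, 2 * κ < ‖x‖ → ‖HOp n V lam (ampWave n Y lam A η ε) x‖ ≤
        (∑ i, (C2 i + 2 * (C1 i * D1) + C0 * D2)) * (1 + ‖x‖) ^ (d - 1 - μ) := by
      intro x hx
      have hx0 : x ≠ 0 := norm_pos_iff.1 (hκ2.trans hx)
      have hp : 0 < 1 + ‖x‖ := by positivity
      have hev : ampWave n Y lam A η ε =ᶠ[𝓝 x]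
          fun y => w y * Complex.exp (b * ((Kfun n Y lam y : ℝ) : ℂ)) := by
        filter_upwards [(isOpen_lt continuous_const continuous_norm).mem_nhds hx] with y hy
        exact hamp y hy
      rw [HOp_congr V lam _ _ x hev, HOp_formula V Y lam w b hb2 x hx0 (hwc2 x hx0)
        (hYs.contDiffAt.of_le two_le_top') hw
        (heik x (by rw [hη1 _ hx]; exact one_ne_zero)), norm_mul, hbre, mul_one, norm_neg,
        Finset.sum_mul]
      refine norm_sum_le_of_le _ fun i _ => ?_
      have e2 : (1 + ‖x‖) ^ (d - 1 - 1) ≤ (1 + ‖x‖) ^ (d - 1 - μ) :=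
        Real.rpow_le_rpow_of_exponent_le (by linarith [norm_nonneg x]) (by linarith)
      have e1 : (1 + ‖x‖) ^ (d - 1) * (1 + ‖x‖) ^ (-μ) = (1 + ‖x‖) ^ (d - 1 - μ) := by
        rw [← Real.rpow_add hp]; congr 1
      have e0 : (1 + ‖x‖) ^ d * (1 + ‖x‖) ^ (-1 - μ) = (1 + ‖x‖) ^ (d - 1 - μ) := by
        rw [← Real.rpow_add hp]; congr 1; ring
      have t2 := (hB2 i x hx).trans (mul_le_mul_of_nonneg_left e2 (hC2 i))
      have t1 := mul_le_mul (hB1 i x hx) (hY1 x i) (abs_nonneg _)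
        (mul_nonneg (hC1 i) (by positivity))
      have t0 := mul_le_mul (hB0 x hx) (hY2 x i) (abs_nonneg _)
        (mul_nonneg hC0 (by positivity))
      refine (norm_sub_le _ _).trans ?_
      refine (add_le_add_left (norm_sub_le _ _) _).trans ?_
      simp only [norm_mul, hbn, Complex.norm_real, Real.norm_eq_abs, Complex.norm_ofNat, one_mul,
        mul_one]
      have s1 : C1 i * (1 + ‖x‖) ^ (d - 1) * (D1 * (1 + ‖x‖) ^ (-μ)) =
          C1 i * D1 * (1 + ‖x‖) ^ (d - 1 - μ) := by rw [← e1]; ring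
      have s0 : C0 * (1 + ‖x‖) ^ d * (D2 * (1 + ‖x‖) ^ (-1 - μ)) =
          C0 * D2 * (1 + ‖x‖) ^ (d - 1 - μ) := by rw [← e0]; ring
      rw [s1] at t1
      rw [s0] at t0
      linarith
    obtain ⟨C, hC, h⟩ := global_bound (HOp n V lam (ampWave n Y lam A η ε))
      (HOp_cont V hV.1.continuous lam _ hsm) (d - 1 - μ) (2 * κ) ⟨_, hfar⟩
    refine l2_bound _ (3/4) (d - 1 - μ) C hC ?_ h
    rw [hd]; linarith
end
end
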